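/- **Architecture.** Fix a depth $L\ge 1$. For $0\le l\le L$ the layer-$l$ activations lie in $\mathbb R^{U_l\times w_l}$ ($U_l$ channels, $w_l$ spatial positions). For $1\le l\le L$ there are $O_{l-1}$ convolutional patches $S^{l-1,o}$ at layer $l-1$, ordered subsets of $\{1,\dots,U_{l-1}\}\times\{1,\dots,w_{l-1}\}$ of cardinality $d_l$; a filter matrix $A^l\in\mathbb R^{m_l\times d_l}$ acts by $\Lambda_{A^l}(x)_{j,o}=\sum_{i=1}^{d_l}x_{S^{l-1,o}_i}A^l_{j,i}$, and $\tilde A^l$ is the matrix of this linear map, with rows indexed by $(j,o)$. The nonlinearity $G_l:\mathbb R^{m_l\times O_{l-1}}\to\mathbb R^{U_l\times w_l}$ (activation and pooling) is $\rho_l$-Lipschitz for the $\ell^\infty$ norms. For $l<L$ the value of each neuron of layer $l$ depends only on the pre-activations in its pooling window (a subset of $\{1,\dots,m_l\}\times\{1,\dots,O_{l-1}\}$), and windows of neurons in different channels of layer $l$ involve different filters (as for spatial pooling, where no pooling takes place over different channels). The last layer is fully connected: $O_{L-1}=1$, its patch is the whole layer $L-1$, and $w_L=1$, $U_L=K\ge2$.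 All dimensions are positive. Put $F_{\mathcal A}=G_L\circ\Lambda_{A^L}\circ\dots\circ G_1\circ\Lambda_{A^1}$, let $F^{0\to l}_{\mathcal A}$ be the subnetwork from the input to the layer-$l$ activations, and let $|x|_l$ be the maximum Euclidean norm of a convolutional patch of the layer-$l$ activation $x$. For $l<L$, $\|\tilde A^l\|_{\sigma'}$ is the maximum spectral norm of a matrix obtained from $\tilde A^l$ by keeping, for each (non-empty) pooling window, exactly one of the rows in that window (with one row for each window); $\|\tilde A^L\|_{\sigma'}$ is the maximum Euclidean norm of a row of $A^L$. $\|A^\top\|_{2,1}$ is the sum of the Euclidean norms of the rows of $A$. Let $\bar W=\max_{l}O_{l-1}m_l$, and let $M^1,\dots,M^L$ be fixed reference matrices, $M^l\in\mathbb R^{m_l\times d_l}$. **Theorem.** Let $(x_1,y_1),\dots,(x_n,y_n)$, $n\ge1$, be i.i.d. observations from a probability distribution on $\mathbb R^{U_0\times w_0}\times\{1,\dots,K\}$, and let $(x,y)$ be distributed in the same way. For every $\delta>0$, with probability at least $1-\delta$ over the training set, the following holds for every $\mathcal A=(A^1,\dots,A^L)$, every margin $\gamma>0$ and every choice of numbers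 $B_l=B_l(X)\ge1$ ($0\le l\le L-1$), which may depend on the data, where $B_L=\gamma$: $$\begin{aligned}\mathbb P\Big(\operatorname*{argmax}_jF_{\mathcal A}(x)_j\ne y\Big)\le{}&\frac{n-\#I}{n}+\frac8n+\frac{3072}{\sqrt n}R_{\mathcal A}\big[\log_2(64\Gamma n^2+7\bar Wn)\big]^{1/2}\log n+3\sqrt{\frac{\log(2/\delta)}{2n}}+\sqrt{\log\frac{2}{\gamma n}}\\&+3\sqrt{\frac1n\sum_{l=1}^L\Big[\log(2+LB_{l-1})+\log\big(2+\|(A^l-M^l)^\top\|_{2,1}\big)+\log\big(2+L\|\tilde A^l\|_{\sigma'}\big)\Big]},\end{aligned}$$ where the square root of a negative number is read as $0$, a tie for the maximal score counts as an error, and $$I=\Big\{i\le n:\ F_{\mathcal A}(x_i)_{y_i}-\max_{j\ne y_i}F_{\mathcal A}(x_i)_j>\gamma\ \text{ and }\ |F^{0\to l}_{\mathcal A}(x_i)|_l\le B_l\ \text{ for all } l\le L-1\Big\},$$ $$P_l=\rho_l\sqrt{w_l}\,\max_{l\le l'\le L}\frac{\prod_{i=l+1}^{l'}\rho_i\big(\|\tilde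 A^i\|_{\sigma'}+\frac1L\big)}{B_{l'}},\qquad R_{\mathcal A}^{2/3}=\sum_{l=1}^L\Big(\big(\|(A^l-M^l)^\top\|_{2,1}+\tfrac1L\big)\big(B_{l-1}+\tfrac1L\big)P_l\Big)^{2/3},$$ $$\Gamma=\max_{1\le l\le L}\Big(\big(B_{l-1}+\tfrac1L\big)\big(\|(A^l-M^l)^\top\|_{2,1}+\tfrac1L\big)\,O_{l-1}\,m_l\,P_l\Big).$$ Moreover, for the choice $B_l=\max\big(\max_{i\le n}|F^{0\to l}_{\mathcal A}(x_i)|_l,\,1\big)$, $l\le L-1$, one has $I=\{i\le n: F_{\mathcal A}(x_i)_{y_i}-\max_{j\ne y_i}F_{\mathcal A}(x_i)_j>\gamma\}$. -/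

import Mathlib

open scoped BigOperators NNReal
open MeasureTheory

/-- A convolutional feedforward architecture of depth `L`.  Layers are numbered `0, …, L`; the data
with index `l` below describes the passage from layer `l` to layer `l + 1`, for `l < L` (values at
other indices are irrelevant).

* `U l`, `w l`: numbers of channels and of spatial positions of the activations of layer `l`;
* `O l`: number of convolutional patches at layer `l`;
* `m (l+1)`, `d (l+1)`: number of filters and size of the patches of the convolution `l → l + 1`;
* `patch l o i`: the `i`-th element of the `o`-th ordered patch of layer `l`;
* `G l`: the nonlinearity (activation and pooling) `ℝ^{m_{l+1} × O_l} → ℝ^{U_{l+1} × w_{l+1}}`,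
  Lipschitz with constant `ρ l` for the sup norms;
* `window l p`: the pooling window of the neuron `p` of a hidden layer `l + 1`, that is, a set of
  pre-activations which determine the value of that neuron (it may be empty for the constant
  neurons that model offset terms). -/
structure ConvArch (L : ℕ) where
  U : ℕ → ℕ
  w : ℕ → ℕ
  m : ℕ → ℕ
  d : ℕ → ℕ
  O : ℕ → ℕ
  U_pos : ∀ l, l ≤ L → 0 < U l
  w_pos : ∀ l, l ≤ L → 0 < w l
  m_pos : ∀ l, l < L → 0 < m (l + 1)
  d_pos : ∀ l, l < L → 0 < d (l + 1)
  O_pos : ∀ l, l < L → 0 < O l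
  patch : (l : ℕ) → Fin (O l) → Fin (d (l + 1)) → Fin (U l) × Fin (w l)
  patch_injective : ∀ l, l < L → ∀ o, Function.Injective (patch l o)
  ρ : ℕ → ℝ≥0
  G : (l : ℕ) → (Fin (m (l + 1)) × Fin (O l) → ℝ) → (Fin (U (l + 1)) × Fin (w (l + 1)) → ℝ)
  G_lipschitz : ∀ l, l < L → LipschitzWith (ρ l) (G l)
  window : (l : ℕ) → Fin (U (l + 1)) × Fin (w (l + 1)) → Finset (Fin (m (l + 1)) × Fin (O l))
  /-- The value of a hidden neuron depends only on the pre-activations in its pooling window. -/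
  G_local : ∀ l, l + 1 < L → ∀ p z z', (∀ q ∈ window l p, z q = z' q) → G l z p = G l z' p
  /-- No two channels of a hidden layer are pooled from the same filter (for instance, each channel
  is obtained from its own filter by spatial pooling). -/
  window_channel : ∀ l, l + 1 < L → ∀ p p' q q', q ∈ window l p → q' ∈ window l p' →
    q.1 = q'.1 → p.1 = p'.1

namespace ConvArch

variable {L : ℕ} (net : ConvArch L)

/-- The activation space `ℝ^{U_l × w_l}`. -/
abbrev Act (l : ℕ) := Fin (net.U l) × Fin (net.w l) → ℝ

/-- The filter matrices `ℝ^{m_{l+1} × d_{l+1}}` of the convolution `l → l + 1`. -/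
abbrev Wt (l : ℕ) := Matrix (Fin (net.m (l + 1))) (Fin (net.d (l + 1))) ℝ

/-- The convolution `Λ_A`. -/
def conv (l : ℕ) (A : net.Wt l) (x : net.Act l) : Fin (net.m (l + 1)) × Fin (net.O l) → ℝ :=
  fun q => ∑ i, x (net.patch l q.2 i) * A q.1 i

/-- The matrix `Ã` which represents `Λ_A`. -/
def convMatrix (l : ℕ) (A : net.Wt l) :
    Matrix (Fin (net.m (l + 1)) × Fin (net.O l)) (Fin (net.U l) × Fin (net.w l)) ℝ :=
  Matrix.of fun q v => ∑ i, if net.patch l q.2 i = v then A q.1 i else 0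

theorem convMatrix_mulVec (l : ℕ) (A : net.Wt l) (x : net.Act l) :
    (net.convMatrix l A).mulVec x = net.conv l A x := by
  funext q
  simp only [Matrix.mulVec, dotProduct, convMatrix, Matrix.of_apply, conv, Finset.sum_mul]
  rw [Finset.sum_comm]
  refine Finset.sum_congr rfl fun i _ => ?_
  simp [mul_comm]

/-- The subnetwork `F^{0→l}_𝒜`. -/
def F (A : ∀ l, net.Wt l) : (l : ℕ) → net.Act 0 → net.Act l
  | 0 => id
  | l + 1 => fun x => net.G l (net.conv l (A l) (F A l x))

/-- `|x|_l`: the maximum Euclidean norm of a convolutional patch of `x`. -/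
noncomputable def patchNorm (l : ℕ) (x : net.Act l) : ℝ :=
  ⨆ o : Fin (net.O l), Real.sqrt (∑ i, (x (net.patch l o i)) ^ 2)

/-- `‖(A − M)^⊤‖_{2,1}`: the sum of the Euclidean norms of the rows of `A − M`. -/
noncomputable def dist21 (l : ℕ) (A M : net.Wt l) : ℝ :=
  ∑ j, Real.sqrt (∑ i, ((A - M) j i) ^ 2)

/-- A choice of one row of `Ã` for each (non-empty) pooling window. -/
abbrev Selection (l : ℕ) :=
  ∀ p : {p : Fin (net.U (l + 1)) × Fin (net.w (l + 1)) // (net.window l p).Nonempty},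
    {q // q ∈ net.window l p.1}

open scoped Matrix.Norms.L2Operator in
/-- `‖Ã^{l+1}‖_{σ'}`.  For a hidden layer: the maximum spectral norm of a matrix obtained from `Ã` by
keeping one row for each pooling window.  For the last layer: the maximum Euclidean norm of a row
of the weight matrix. -/
noncomputable def sigmaPrime (l : ℕ) (A : net.Wt l) : ℝ :=
  if l + 1 = L then ⨆ j, Real.sqrt (∑ i, (A j i) ^ 2)
  else ⨆ sel : net.Selection l, ‖(net.convMatrix l A).submatrix (fun p => (sel p).1) id‖

/-- The last layer is fully connected: a single patch, which contains all neurons of layer `L - 1`,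
and an output without spatial extension. -/
def LastFullyConnected : Prop :=
  net.w L = 1 ∧ ∀ l, l + 1 = L → net.O l = 1 ∧ ∀ o, Function.Surjective (net.patch l o)

/-- The score `F_𝒜(x)_c` of the class `c`. -/
def score (A : ∀ l, net.Wt l) (x : net.Act 0) (c : Fin (net.U L)) : ℝ :=
  net.F A L x (c, ⟨0, net.w_pos L le_rfl⟩)

/-- The margin `F_𝒜(x)_y − max_{j ≠ y} F_𝒜(x)_j`. -/
noncomputable def margin (A : ∀ l, net.Wt l) (x : net.Act 0) (y : Fin (net.U L)) : ℝ :=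
  net.score A x y - ⨆ j : {j : Fin (net.U L) // j ≠ y}, net.score A x j

/-- The event `argmax_j F_𝒜(x)_j ≠ y`; a tie for the maximum counts as an error. -/
def errorSet (A : ∀ l, net.Wt l) : Set (net.Act 0 × Fin (net.U L)) :=
  {p | ∃ c, c ≠ p.2 ∧ net.score A p.1 p.2 ≤ net.score A p.1 c}

/-- The set `I` of the well classified sample points whose hidden activations are controlled. -/
def goodSet {n : ℕ} (A : ∀ l, net.Wt l) (γ : ℝ) (B : ℕ → ℝ)
    (s : Fin n → net.Act 0 × Fin (net.U L)) : Set (Fin n) :=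
  {i | γ < net.margin A (s i).1 (s i).2 ∧
    ∀ l, l < L → net.patchNorm l (net.F A l (s i).1) ≤ B l}

/-- The choice `B_l = max (max_i |F^{0→l}_𝒜(x_i)|_l, 1)` for `l < L`, and `B_L = γ`. -/
noncomputable def empiricalB {n : ℕ} (A : ∀ l, net.Wt l) (γ : ℝ)
    (s : Fin n → net.Act 0 × Fin (net.U L)) (l : ℕ) : ℝ :=
  if l = L then γ else max (⨆ i, net.patchNorm l (net.F A l (s i).1)) 1

/-- `ρ_l √w_l max_{l ≤ l' ≤ L} [∏_{i=l+1}^{l'} ρ_i (‖Ã^i‖_{σ'} + 1/L)] / B_{l'}`, for the layer `l`;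
the filter matrix `A^i` and the constant `ρ_i` have index `i - 1` here, so the argument is `l - 1`. -/
noncomputable def specFactor (A : ∀ l, net.Wt l) (B : ℕ → ℝ) (l : ℕ) : ℝ :=
  net.ρ l * Real.sqrt (net.w (l + 1)) *
    ⨆ l' : Finset.Icc (l + 1) L,
      (∏ i ∈ Finset.Ico (l + 1) (l' : ℕ), (net.ρ i : ℝ) * (net.sigmaPrime i (A i) + 1 / (L : ℝ))) /
        B l'

/-- `R_𝒜`. -/
noncomputable def complexityR (M A : ∀ l, net.Wt l) (B : ℕ → ℝ) : ℝ :=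
  (∑ l ∈ Finset.range L,
    ((net.dist21 l (A l) (M l) + 1 / (L : ℝ)) * (B l + 1 / (L : ℝ)) * net.specFactor A B l) ^
      ((2 : ℝ) / 3)) ^ ((3 : ℝ) / 2)

/-- `Γ`. -/
noncomputable def complexityGamma (M A : ∀ l, net.Wt l) (B : ℕ → ℝ) : ℝ :=
  ⨆ l : Fin L, (B l + 1 / (L : ℝ)) * (net.dist21 l (A l) (M l) + 1 / (L : ℝ)) *
    ((net.O l : ℝ) * (net.m (l + 1) : ℝ)) * net.specFactor A B l

/-- `W̄ = max_l O_{l-1} m_l`: the maximum width before pooling. -/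
noncomputable def prePoolWidth : ℝ :=
  ⨆ l : Fin L, (net.O l : ℝ) * (net.m (l + 1) : ℝ)

end ConvArch

/-! ### Rademacher averages on the discrete cube -/

namespace Rademacher

/-- The sign attached to a Boolean. -/
def sgn (b : Bool) : ℝ := if b then 1 else -1

theorem abs_sgn (b : Bool) : |sgn b| = 1 := by
  cases b <;> simp [sgn]

/-- The average of a function on the cube `{±1}^n`. -/
noncomputable def mean {n : ℕ} (h : (Fin n → Bool) → ℝ) : ℝ := (∑ σ, h σ) / 2 ^ n

variable {n : ℕ}

theorem mean_mono {h k : (Fin n → Bool) → ℝ} (H : ∀ σ, h σ ≤ k σ) : mean h ≤ mean k := by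
  unfold mean
  gcongr
  exact H _

theorem mean_const (c : ℝ) : mean (fun _ : Fin n → Bool => c) = c := by
  simp [mean]

theorem mean_add (h k : (Fin n → Bool) → ℝ) :
    mean (fun σ => h σ + k σ) = mean h + mean k := by
  simp [mean, Finset.sum_add_distrib, add_div]

theorem mean_const_mul (c : ℝ) (h : (Fin n → Bool) → ℝ) :
    mean (fun σ => c * h σ) = c * mean h := by
  simp [mean, ← Finset.mul_sum, mul_div_assoc]

theorem mean_sum {ι : Type*} (s : Finset ι) (h : ι → (Fin n → Bool) → ℝ) :
    mean (fun σ => ∑ i ∈ s, h i σ) = ∑ i ∈ s, mean (h i) := by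
  simp only [mean]
  rw [Finset.sum_comm, Finset.sum_div]

theorem mean_succ (h : (Fin (n + 1) → Bool) → ℝ) :
    mean h = mean fun σ : Fin n → Bool => (h (Fin.cons true σ) + h (Fin.cons false σ)) / 2 := by
  simp only [mean]
  rw [← (Fin.consEquiv fun _ => Bool).sum_comp, Fintype.sum_prod_type, Fintype.sum_bool,
    ← Finset.sum_add_distrib, ← Finset.sum_div, pow_succ, div_div, mul_comm (2 : ℝ)]
  rfl

theorem exp_mean_le (h : (Fin n → Bool) → ℝ) :
    Real.exp (mean h) ≤ mean fun σ => Real.exp (h σ) := by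
  have key : ∀ σ, Real.exp (mean h) * (1 - mean h) + Real.exp (mean h) * h σ ≤ Real.exp (h σ) := by
    intro σ
    have := Real.add_one_le_exp (h σ - mean h)
    have h2 : Real.exp (h σ) = Real.exp (mean h) * Real.exp (h σ - mean h) := by
      rw [← Real.exp_add]; congr 1; ring
    rw [h2, ← mul_add]
    exact mul_le_mul_of_nonneg_left (by linarith) (Real.exp_pos _).le
  have := mean_mono key
  rw [mean_add, mean_const, mean_const_mul] at this
  linarith

/-- The Rademacher sum `∑ σ_i g_i`. -/
noncomputable def rsum (σ : Fin n → Bool) (g : Fin n → ℝ) : ℝ := ∑ i, sgn (σ i) * g i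

theorem rsum_le {σ : Fin n → Bool} {g : Fin n → ℝ} {c : ℝ} (hg : ∀ i, |g i| ≤ c) :
    rsum σ g ≤ n * c := by
  calc rsum σ g ≤ ∑ _i : Fin n, c := by
        refine Finset.sum_le_sum fun i _ => (le_abs_self _).trans ?_
        rw [abs_mul, abs_sgn, one_mul]
        exact hg i
    _ = n * c := by simp

theorem rsum_add (σ : Fin n → Bool) (g k : Fin n → ℝ) :
    rsum σ (fun i => g i + k i) = rsum σ g + rsum σ k := by
  simp [rsum, mul_add, Finset.sum_add_distrib]

theorem mean_exp_rsum_le {g : Fin n → ℝ} {c : ℝ} (hg : ∀ i, |g i| ≤ c) (t : ℝ) :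
    mean (fun σ => Real.exp (t * rsum σ g)) ≤ Real.exp (t ^ 2 * c ^ 2 * n / 2) := by
  have h1 : ∑ σ : Fin n → Bool, Real.exp (t * rsum σ g) = ∏ i, (2 * Real.cosh (t * g i)) := by
    have := Finset.prod_univ_sum (fun _ : Fin n => (Finset.univ : Finset Bool))
      (fun i b => Real.exp (t * (sgn b * g i)))
    rw [Fintype.piFinset_univ] at this
    rw [show (∏ i, (2 * Real.cosh (t * g i))) =
      ∏ i, ∑ b : Bool, Real.exp (t * (sgn b * g i)) from ?_, this]
    · refine Finset.sum_congr rfl fun σ _ => ?_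
      rw [← Real.exp_sum, rsum, Finset.mul_sum]
    · refine Finset.prod_congr rfl fun i _ => ?_
      rw [Fintype.sum_bool, Real.cosh_eq]
      simp [sgn]
      ring
  rw [mean, h1, Finset.prod_mul_distrib, Finset.prod_const, Finset.card_univ, Fintype.card_fin,
    mul_div_cancel_left₀ _ (by positivity)]
  calc ∏ i, Real.cosh (t * g i) ≤ ∏ _i : Fin n, Real.exp (t ^ 2 * c ^ 2 / 2) := by
        refine Finset.prod_le_prod (fun i _ => (Real.cosh_pos _).le) fun i _ => ?_
        refine (Real.cosh_le_exp_half_sq _).trans (Real.exp_le_exp.2 ?_)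
        have : g i ^ 2 ≤ c ^ 2 := by
          rw [← sq_abs]; exact pow_le_pow_left₀ (abs_nonneg _) (hg i) 2
        rw [mul_pow]
        gcongr
    _ = _ := by
        rw [Finset.prod_const, Finset.card_univ, Fintype.card_fin, ← Real.exp_nat_mul]
        congr 1; ring

/-- The maximal inequality for Rademacher sums over a finite set of vectors. -/
theorem mean_sup'_le (G : Finset (Fin n → ℝ)) (hG : G.Nonempty) {c Λ : ℝ} (hc : 0 < c)
    (hn : 0 < n) (hΛ : 0 ≤ Λ) (hcard : (G.card : ℝ) ≤ Real.exp Λ) (hb : ∀ g ∈ G, ∀ i, |g i| ≤ c) :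
    mean (fun σ => G.sup' hG (rsum σ)) ≤ c * Real.sqrt (2 * n * Λ) := by
  have hn' : (0 : ℝ) < n := by exact_mod_cast hn
  have step : ∀ t : ℝ, 0 < t →
      t * mean (fun σ => G.sup' hG (rsum σ)) ≤ Λ + t ^ 2 * c ^ 2 * n / 2 := by
    intro t ht
    rw [← Real.exp_le_exp, ← mean_const_mul]
    refine (exp_mean_le _).trans ?_
    have : ∀ σ : Fin n → Bool, Real.exp (t * G.sup' hG (rsum σ)) ≤
        ∑ g ∈ G, Real.exp (t * rsum σ g) := by
      intro σ
      obtain ⟨g, hg, hgeq⟩ := G.exists_mem_eq_sup' hG (rsum σ)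
      rw [hgeq]
      exact Finset.single_le_sum (f := fun g => Real.exp (t * rsum σ g))
        (fun _ _ => (Real.exp_pos _).le) hg
    refine (mean_mono this).trans ?_
    rw [mean_sum, Real.exp_add]
    refine (Finset.sum_le_sum fun g hg => mean_exp_rsum_le (hb g hg) t).trans ?_
    rw [Finset.sum_const, nsmul_eq_mul]
    gcongr
  set m := mean (fun σ => G.sup' hG (rsum σ)) with hm
  rcases hΛ.eq_or_lt with h0 | h0
  · subst h0
    simp only [mul_zero, Real.sqrt_zero]
    by_contra! hpos
    have h := step (m / (c ^ 2 * n)) (by positivity)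
    have e1 : m / (c ^ 2 * n) * m = m ^ 2 / (c ^ 2 * n) := by ring
    have e2 : (m / (c ^ 2 * n)) ^ 2 * c ^ 2 * n / 2 = (m ^ 2 / (c ^ 2 * n)) / 2 := by
      field_simp
    rw [e1, e2] at h
    have : 0 < m ^ 2 / (c ^ 2 * n) := by positivity
    linarith
  · set r := Real.sqrt (2 * n * Λ) with hr
    have hrpos : 0 < r := Real.sqrt_pos.2 (by positivity)
    have hr2 : r ^ 2 = 2 * n * Λ := Real.sq_sqrt (by positivity)
    have h := step (r / (c * n)) (by positivity)
    have e2 : (r / (c * n)) ^ 2 * c ^ 2 * n / 2 = Λ := by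
      rw [div_pow, hr2]; field_simp
    rw [e2] at h
    have e3 : Λ + Λ = r / (c * n) * (c * r) := by
      have : r / (c * n) * (c * r) = r ^ 2 / n := by field_simp
      rw [this, hr2]; field_simp; ring
    rw [e3] at h
    exact le_of_mul_le_mul_left h (by positivity)

/-- The exponential moment bound for functions with bounded differences on the cube. -/
theorem mean_exp_le_of_bounded_differences {c : ℝ} (t : ℝ) :
    ∀ {n : ℕ} (h : (Fin n → Bool) → ℝ),
      (∀ σ i b, |h (Function.update σ i b) - h σ| ≤ c) →
      mean (fun σ => Real.exp (t * h σ)) ≤ Real.exp (t * mean h + t ^ 2 * c ^ 2 * n / 8) := by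
  intro n
  induction n with
  | zero =>
    intro h _
    simp [mean]
  | succ n ih =>
    intro h hc
    set k : (Fin n → Bool) → ℝ := fun σ => (h (Fin.cons true σ) + h (Fin.cons false σ)) / 2 with hk
    have hkc : ∀ σ i b, |k (Function.update σ i b) - k σ| ≤ c := by
      intro σ i b
      have h1 := hc (Fin.cons true σ) i.succ b
      have h2 := hc (Fin.cons false σ) i.succ b
      rw [← Fin.cons_update] at h1 h2
      rw [abs_le] at h1 h2 ⊢
      simp only [hk]
      constructor <;> linarith [h1.1, h1.2, h2.1, h2.2]
    rw [mean_succ, mean_succ h]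
    have hpt : ∀ σ : Fin n → Bool,
        (Real.exp (t * h (Fin.cons true σ)) + Real.exp (t * h (Fin.cons false σ))) / 2 ≤
          Real.exp (t ^ 2 * c ^ 2 / 8) * Real.exp (t * k σ) := by
      intro σ
      set x := h (Fin.cons true σ)
      set y := h (Fin.cons false σ)
      have e : (Real.exp (t * x) + Real.exp (t * y)) / 2 =
          Real.cosh (t * (x - y) / 2) * Real.exp (t * k σ) := by
        rw [Real.cosh_eq, div_mul_eq_mul_div, add_mul, ← Real.exp_add, ← Real.exp_add]
        congr 3 <;> simp only [hk] <;> ring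
      rw [e]
      gcongr
      refine (Real.cosh_le_exp_half_sq _).trans (Real.exp_le_exp.2 ?_)
      have h1 := hc (Fin.cons false σ) 0 true
      rw [Fin.update_cons_zero] at h1
      have : (x - y) ^ 2 ≤ c ^ 2 := by
        rw [← sq_abs]; exact pow_le_pow_left₀ (abs_nonneg _) h1 2
      have := mul_le_mul_of_nonneg_left this (sq_nonneg t)
      nlinarith
    refine (mean_mono hpt).trans ?_
    rw [mean_const_mul]
    refine (mul_le_mul_of_nonneg_left (ih k hkc) (Real.exp_pos _).le).trans ?_
    rw [← Real.exp_add, Real.exp_le_exp]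
    push_cast
    apply le_of_eq
    ring

/-- Chaining: a bound on the Rademacher average of a family of vectors from finite coverings at all
dyadic scales. -/
theorem mean_iSup_rsum_le {ι : Type*} [Nonempty ι] (hn : 0 < n) (v : ι → Fin n → ℝ)
    (hv : ∀ f i, |v f i| ≤ 1) {Q : ℝ} (hQ : 0 ≤ Q) (K : ℕ)
    (hcov : ∀ k, ∃ N : Finset (Fin n → ℝ), (N.card : ℝ) ≤ Real.exp (Q * 4 ^ (k + 1)) ∧
      ∀ f, ∃ u ∈ N, ∀ i, |v f i - u i| ≤ 2 / 2 ^ (k + 1)) :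
    mean (fun σ => ⨆ f, rsum σ (v f)) ≤
      n * (2 / 2 ^ K) + K * (6 * Real.sqrt (5 / 2 * n * Q)) := by
  classical
  have hcov' : ∀ k : ℕ, ∃ N : Finset (Fin n → ℝ), (N.card : ℝ) ≤ Real.exp (Q * 4 ^ k) ∧
      (k = 0 → N = {0}) ∧ ∀ f, ∃ u ∈ N, ∀ i, |v f i - u i| ≤ 2 / 2 ^ k := by
    rintro (_ | k)
    · refine ⟨{0}, by simpa using hQ, fun _ => rfl, fun f => ⟨0, by simp, fun i => ?_⟩⟩
      simpa using (hv f i).trans one_le_two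
    · obtain ⟨N, h1, h2⟩ := hcov k
      exact ⟨N, h1, by simp, h2⟩
  choose N hcard hN0 hN using hcov'
  choose π hπN hπ using hN
  set G : ℕ → Finset (Fin n → ℝ) := fun k =>
    ((N (k + 1) ×ˢ N k).image fun p => p.1 - p.2).filter fun g => ∀ i, |g i| ≤ 6 / 2 ^ (k + 1)
  have hmem : ∀ k f, π (k + 1) f - π k f ∈ G k := by
    intro k f
    refine Finset.mem_filter.2 ⟨Finset.mem_image.2
      ⟨(π (k + 1) f, π k f), Finset.mem_product.2 ⟨hπN _ _, hπN _ _⟩, rfl⟩, fun i => ?_⟩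
    have h1 := hπ (k + 1) f i
    have h2 := hπ k f i
    have e : (2 : ℝ) / 2 ^ k = 4 / 2 ^ (k + 1) := by rw [pow_succ]; field_simp; norm_num
    rw [e] at h2
    have e' : (6 : ℝ) / 2 ^ (k + 1) = 2 / 2 ^ (k + 1) + 4 / 2 ^ (k + 1) := by rw [← add_div]; norm_num
    rw [e', Pi.sub_apply]
    calc |π (k + 1) f i - π k f i| = |(v f i - π k f i) - (v f i - π (k + 1) f i)| := by congr 1; ring
      _ ≤ _ := (abs_sub _ _).trans (by linarith)
  have f0 : ι := Classical.arbitrary ι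
  have hne : ∀ k, (G k).Nonempty := fun k => ⟨_, hmem k f0⟩
  have hGcard : ∀ k, ((G k).card : ℝ) ≤ Real.exp (5 / 4 * Q * 4 ^ (k + 1)) := by
    intro k
    have h1 : (G k).card ≤ (N (k + 1)).card * (N k).card :=
      (Finset.card_filter_le _ _).trans (Finset.card_image_le.trans (Finset.card_product _ _).le)
    calc ((G k).card : ℝ) ≤ (N (k + 1)).card * (N k).card := by exact_mod_cast h1
      _ ≤ Real.exp (Q * 4 ^ (k + 1)) * Real.exp (Q * 4 ^ k) := by
          gcongr
          · exact hcard _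
          · exact hcard _
      _ = _ := by rw [← Real.exp_add, pow_succ]; congr 1; ring
  have hlink : ∀ k, mean (fun σ => (G k).sup' (hne k) (rsum σ)) ≤ 6 * Real.sqrt (5 / 2 * n * Q) := by
    intro k
    refine (mean_sup'_le (G k) (hne k) (c := 6 / 2 ^ (k + 1)) (by positivity) hn (by positivity)
      (hGcard k) fun g hg => (Finset.mem_filter.1 hg).2).trans (le_of_eq ?_)
    have : (2 : ℝ) * n * (5 / 4 * Q * 4 ^ (k + 1)) = (2 ^ (k + 1)) ^ 2 * (5 / 2 * n * Q) := by
      rw [← pow_mul, mul_comm (k + 1) 2, pow_mul]; norm_num; ring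
    rw [this, Real.sqrt_mul (by positivity), Real.sqrt_sq (by positivity)]
    field_simp
  have hpt : ∀ σ : Fin n → Bool, ⨆ f, rsum σ (v f) ≤
      n * (2 / 2 ^ K) + ∑ k ∈ Finset.range K, (G k).sup' (hne k) (rsum σ) := by
    intro σ
    refine ciSup_le fun f => ?_
    have tele : v f = fun i => (v f i - π K f i) +
        ((∑ k ∈ Finset.range K, (π (k + 1) f - π k f)) i + π 0 f i) := by
      funext i
      rw [Finset.sum_range_sub (fun k => π k f)]
      simp
    have hlin : ∀ m, rsum σ (∑ k ∈ Finset.range m, (π (k + 1) f - π k f)) =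
        ∑ k ∈ Finset.range m, rsum σ (π (k + 1) f - π k f) := by
      intro m
      simp only [rsum, Finset.sum_apply, Finset.mul_sum]
      rw [Finset.sum_comm]
    have h0 : π 0 f = 0 := by simpa [hN0 0 rfl] using hπN 0 f
    rw [tele, rsum_add, rsum_add, hlin, h0]
    have hz : rsum σ (0 : Fin n → ℝ) = 0 := by simp [rsum]
    have h1 : rsum σ (fun i => v f i - π K f i) ≤ n * (2 / 2 ^ K) := rsum_le (hπ K f)
    have h2 : ∑ k ∈ Finset.range K, rsum σ (π (k + 1) f - π k f) ≤
        ∑ k ∈ Finset.range K, (G k).sup' (hne k) (rsum σ) :=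
      Finset.sum_le_sum fun k _ => Finset.le_sup' (rsum σ) (hmem k f)
    have h3 : rsum σ (fun i => (0 : Fin n → ℝ) i) = 0 := hz
    linarith
  refine (mean_mono hpt).trans ?_
  rw [mean_add, mean_const, mean_sum]
  gcongr
  refine (Finset.sum_le_sum fun k _ => hlink k).trans ?_
  simp

end Rademacher

/-! ### Symmetrization -/

namespace Rademacher

variable {n : ℕ}

/-- Exchange the two components of the pairs with a negative sign. -/
def swapBy {X : Type*} (σ : Fin n → Bool) (z : Fin n → X × X) : Fin n → X × X :=
  fun i => if σ i then z i else (z i).swap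

theorem measurePreserving_swapBy {X : Type*} [MeasurableSpace X] (μ : Measure X)
    [IsProbabilityMeasure μ] (σ : Fin n → Bool) :
    MeasurePreserving (swapBy σ) (Measure.pi fun _ : Fin n => μ.prod μ)
      (Measure.pi fun _ : Fin n => μ.prod μ) := by
  refine measurePreserving_pi (fun _ => μ.prod μ) (fun _ => μ.prod μ)
    (f := fun i p => if σ i then p else p.swap) fun i => ?_
  cases h : σ i
  · simpa [h] using Measure.measurePreserving_swap (μ := μ) (ν := μ)
  · simp only [if_true]
    exact MeasurePreserving.id (μ.prod μ)

theorem rsum_eq_sum_swapBy {X : Type*} (σ : Fin n → Bool) (z : Fin n → X × X) (f : X → ℝ) :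
    ∑ i, (f (swapBy σ z i).1 - f (swapBy σ z i).2) =
      rsum σ fun i => f (z i).1 - f (z i).2 := by
  refine Finset.sum_congr rfl fun i _ => ?_
  cases h : σ i <;> simp [swapBy, sgn, h]

theorem bddAbove_rsum {ι : Type*} {v : ι → Fin n → ℝ} (hv : ∀ f i, |v f i| ≤ 1)
    (σ : Fin n → Bool) : BddAbove (Set.range fun f => rsum σ (v f)) := by
  refine ⟨n * 1, ?_⟩
  rintro _ ⟨f, rfl⟩
  exact rsum_le (hv f)

theorem abs_iSup_rsum_update_sub_le {ι : Type*} [Nonempty ι] {v : ι → Fin n → ℝ}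
    (hv : ∀ f i, |v f i| ≤ 1) (σ : Fin n → Bool) (i : Fin n) (b : Bool) :
    |(⨆ f, rsum (Function.update σ i b) (v f)) - ⨆ f, rsum σ (v f)| ≤ 2 := by
  have key : ∀ (σ τ : Fin n → Bool), (∀ j, j ≠ i → σ j = τ j) → ∀ f,
      rsum σ (v f) ≤ rsum τ (v f) + 2 := by
    intro σ τ hστ f
    have : rsum σ (v f) - rsum τ (v f) = (sgn (σ i) - sgn (τ i)) * v f i := by
      rw [rsum, rsum, ← Finset.sum_sub_distrib, Finset.sum_eq_single i]
      · ring
      · intro j _ hj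
        rw [hστ j hj, sub_self]
      · simp
    have h2 : (sgn (σ i) - sgn (τ i)) * v f i ≤ 2 := by
      refine (le_abs_self _).trans ?_
      rw [abs_mul]
      have h3 : |sgn (σ i) - sgn (τ i)| ≤ 2 := by
        refine (abs_sub _ _).trans ?_
        rw [abs_sgn, abs_sgn]; norm_num
      nlinarith [hv f i, abs_nonneg (v f i), abs_nonneg (sgn (σ i) - sgn (τ i))]
    linarith
  have key2 : ∀ (σ τ : Fin n → Bool), (∀ j, j ≠ i → σ j = τ j) →
      (⨆ f, rsum σ (v f)) ≤ (⨆ f, rsum τ (v f)) + 2 := by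
    intro σ τ h
    refine ciSup_le fun f => (key σ τ h f).trans ?_
    gcongr
    exact le_ciSup (bddAbove_rsum hv τ) f
  rw [abs_le]
  constructor
  · linarith [key2 σ (Function.update σ i b) fun j hj => by simp [Function.update_of_ne hj]]
  · linarith [key2 (Function.update σ i b) σ fun j hj => by simp [Function.update_of_ne hj]]

end Rademacher

open Rademacher

/-- A uniform deviation inequality for a family of continuous functions with values in `[0, 1]`,
from a uniform bound for their Rademacher averages. -/
theorem measure_exists_deviation_le {X : Type*} [TopologicalSpace X] [SecondCountableTopology X]
    [MeasurableSpace X] [BorelSpace X] (μ : Measure X) [IsProbabilityMeasure μ] {n : ℕ} (hn : 0 < n)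
    {ι : Type*} (f : ι → X → ℝ) (hf : ∀ i, Continuous (f i)) (hf0 : ∀ i x, 0 ≤ f i x)
    (hf1 : ∀ i x, f i x ≤ 1) (D t : ℝ) (ht : 0 ≤ t)
    (hD : ∀ z : Fin n → X × X,
      mean (fun σ => ⨆ i, rsum σ fun j => f i (z j).1 - f i (z j).2) ≤ n * D) :
    (Measure.pi fun _ : Fin n => μ)
      {s | ∃ i, D + t < (∫ x, f i x ∂μ) - (∑ j, f i (s j)) / n} ≤
        ENNReal.ofReal (Real.exp (-(n * t ^ 2 / 2))) := by
  rcases isEmpty_or_nonempty ι with hι | hι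
  · simp
  have hn' : (0 : ℝ) < n := by exact_mod_cast hn
  set P := Measure.pi fun _ : Fin n => μ with hP
  -- the exponential moments, with ghost sample
  set Φ : (Fin n → X) × (Fin n → X) → ENNReal := fun z =>
    ⨆ i, ENNReal.ofReal (Real.exp (t * ∑ j, (f i (z.1 j) - f i (z.2 j)))) with hΦ
  have hΦm : Measurable Φ := by
    apply LowerSemicontinuous.measurable
    refine lowerSemicontinuous_iSup fun i => Continuous.lowerSemicontinuous ?_
    have := hf i
    refine ENNReal.continuous_ofReal.comp ?_
    fun_prop
  have hint : ∀ i, Integrable (f i) μ := fun i =>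
    Integrable.of_bound (hf i).measurable.aestronglyMeasurable 1 (Filter.Eventually.of_forall fun x => by
      rw [Real.norm_eq_abs, abs_le]; exact ⟨by linarith [hf0 i x], hf1 i x⟩)
  have hghost : ∀ i s, ENNReal.ofReal (Real.exp (t * (n * (∫ x, f i x ∂μ) - ∑ j, f i (s j)))) ≤
      ∫⁻ s', Φ (s', s) ∂P := by
    intro i s
    have hgm : Measurable fun s' : Fin n → X => ∑ j, (f i (s' j) - f i (s j)) := by
      have := hf i
      have h2 : Continuous fun s' : Fin n → X => ∑ j, (f i (s' j) - f i (s j)) := by fun_prop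
      exact h2.measurable
    have hgb : ∀ s' : Fin n → X, |∑ j, (f i (s' j) - f i (s j))| ≤ n := by
      intro s'
      refine (Finset.abs_sum_le_sum_abs _ _).trans ?_
      calc _ ≤ ∑ _j : Fin n, (1 : ℝ) := Finset.sum_le_sum fun j _ => by
            rw [abs_le]
            constructor <;> linarith [hf0 i (s j), hf0 i (s' j), hf1 i (s j), hf1 i (s' j)]
        _ = n := by simp
    have hexpint : Integrable (fun s' : Fin n → X =>
        Real.exp (t * ∑ j, (f i (s' j) - f i (s j)))) P := by
      refine Integrable.of_bound (hgm.const_mul t).exp.aestronglyMeasurable (Real.exp (t * n))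
        (Filter.Eventually.of_forall fun s' => ?_)
      rw [Real.norm_eq_abs, Real.abs_exp]
      gcongr
      exact (le_abs_self _).trans (hgb s')
    have hgint : Integrable (fun s' : Fin n → X => t * ∑ j, (f i (s' j) - f i (s j))) P := by
      refine Integrable.const_mul ?_ t
      exact Integrable.of_bound hgm.aestronglyMeasurable n (Filter.Eventually.of_forall hgb)
    have hmean : ∫ s', t * ∑ j, (f i (s' j) - f i (s j)) ∂P =
        t * (n * (∫ x, f i x ∂μ) - ∑ j, f i (s j)) := by
      rw [integral_const_mul]
      congr 1
      rw [integral_finsetSum]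
      · have : ∀ j : Fin n, ∫ s' : Fin n → X, (f i (s' j) - f i (s j)) ∂P =
            (∫ x, f i x ∂μ) - f i (s j) := by
          intro j
          rw [integral_sub]
          · rw [hP, integral_comp_eval (μ := fun _ : Fin n => μ) (hf i).measurable.aestronglyMeasurable]
            simp
          · exact (measurePreserving_eval (fun _ : Fin n => μ) j).integrable_comp_of_integrable (hint i)
          · exact integrable_const _
        simp [this]
      · intro j _
        refine Integrable.sub ?_ (integrable_const _)
        exact (measurePreserving_eval (fun _ : Fin n => μ) j).integrable_comp_of_integrable (hint i)
    have hJ := ConvexOn.map_integral_le convexOn_exp Real.continuous_exp.continuousOn isClosed_univ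
      (Filter.Eventually.of_forall fun _ => Set.mem_univ _) hgint hexpint
    rw [hmean] at hJ
    refine (ENNReal.ofReal_le_ofReal hJ).trans ?_
    rw [ofReal_integral_eq_lintegral_ofReal hexpint
      (Filter.Eventually.of_forall fun _ => (Real.exp_pos _).le)]
    refine lintegral_mono fun s' => ?_
    exact le_iSup (fun i => ENNReal.ofReal (Real.exp (t * ∑ j, (f i (s' j) - f i (s j))))) i
  have hsub : {s | ∃ i, D + t < (∫ x, f i x ∂μ) - (∑ j, f i (s j)) / n} ⊆
      {s | ENNReal.ofReal (Real.exp (t * (n * (D + t)))) ≤ ∫⁻ s', Φ (s', s) ∂P} := by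
    rintro s ⟨i, hi⟩
    refine le_trans (ENNReal.ofReal_le_ofReal (Real.exp_le_exp.2 ?_)) (hghost i s)
    refine mul_le_mul_of_nonneg_left ?_ ht
    have := mul_le_mul_of_nonneg_left hi.le hn'.le
    rw [mul_sub, mul_div_cancel₀ _ hn'.ne'] at this
    exact this
  have hmeas : Measurable fun s => ∫⁻ s', Φ (s', s) ∂P :=
    Measurable.lintegral_prod_left' hΦm
  have hmarkov := mul_meas_ge_le_lintegral (μ := P) hmeas
    (ENNReal.ofReal (Real.exp (t * (n * (D + t)))))
  -- symmetrization
  have hsym : ∫⁻ s, ∫⁻ s', Φ (s', s) ∂P ∂P ≤ ENNReal.ofReal (Real.exp (t * (n * D) + n * t ^ 2 / 2)) := by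
    rw [← lintegral_prod_symm' _ hΦm]
    have hmp := measurePreserving_arrowProdEquivProdArrow X X (Fin n) (fun _ => μ) (fun _ => μ)
    rw [← hP] at hmp
    rw [← hmp.lintegral_comp hΦm]
    set Ψ : (Fin n → X × X) → ENNReal := fun z =>
      Φ (MeasurableEquiv.arrowProdEquivProdArrow X X (Fin n) z) with hΨ
    have hΨm : Measurable Ψ := hΦm.comp hmp.measurable
    have hΨz : ∀ z, Ψ z = ⨆ i, ENNReal.ofReal (Real.exp (t * ∑ j, (f i (z j).1 - f i (z j).2))) :=
      fun z => rfl
    have havg : (2 ^ n : ENNReal) * ∫⁻ z, Ψ z ∂(Measure.pi fun _ : Fin n => μ.prod μ) =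
        ∫⁻ z, ∑ σ : Fin n → Bool, Ψ (swapBy σ z) ∂(Measure.pi fun _ : Fin n => μ.prod μ) := by
      rw [lintegral_finsetSum]
      · have : ∀ σ : Fin n → Bool, ∫⁻ z, Ψ (swapBy σ z) ∂(Measure.pi fun _ : Fin n => μ.prod μ) =
            ∫⁻ z, Ψ z ∂(Measure.pi fun _ : Fin n => μ.prod μ) := fun σ =>
          (measurePreserving_swapBy μ σ).lintegral_comp hΨm
        simp [this]
      · intro σ _
        exact hΨm.comp (measurePreserving_swapBy μ σ).measurable
    have hpt : ∀ z, ∑ σ : Fin n → Bool, Ψ (swapBy σ z) ≤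
        2 ^ n * ENNReal.ofReal (Real.exp (t * (n * D) + n * t ^ 2 / 2)) := by
      intro z
      set v : ι → Fin n → ℝ := fun i j => f i (z j).1 - f i (z j).2 with hv
      have hv1 : ∀ i j, |v i j| ≤ 1 := by
        intro i j
        rw [abs_le]
        constructor <;> simp only [hv] <;>
          linarith [hf0 i (z j).1, hf0 i (z j).2, hf1 i (z j).1, hf1 i (z j).2]
      have h1 : ∀ σ : Fin n → Bool, Ψ (swapBy σ z) ≤
          ENNReal.ofReal (Real.exp (t * ⨆ i, rsum σ (v i))) := by
        intro σ
        rw [hΨz]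
        refine iSup_le fun i => ENNReal.ofReal_le_ofReal (Real.exp_le_exp.2 ?_)
        rw [rsum_eq_sum_swapBy]
        exact mul_le_mul_of_nonneg_left (le_ciSup (bddAbove_rsum hv1 σ) i) ht
      refine (Finset.sum_le_sum fun σ _ => h1 σ).trans ?_
      rw [← ENNReal.ofReal_sum_of_nonneg fun _ _ => (Real.exp_pos _).le]
      have h2 := mean_exp_le_of_bounded_differences t (fun σ => ⨆ i, rsum σ (v i))
        (abs_iSup_rsum_update_sub_le hv1)
      have h3 : Real.exp (t * mean (fun σ => ⨆ i, rsum σ (v i)) + t ^ 2 * 2 ^ 2 * n / 8) ≤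
          Real.exp (t * (n * D) + n * t ^ 2 / 2) := by
        rw [Real.exp_le_exp]
        have := mul_le_mul_of_nonneg_left (hD z) ht
        linarith
      have h4 := h2.trans h3
      rw [mean, div_le_iff₀ (by positivity)] at h4
      calc _ ≤ ENNReal.ofReal (Real.exp (t * (n * D) + n * t ^ 2 / 2) * 2 ^ n) :=
            ENNReal.ofReal_le_ofReal h4
        _ = _ := by
            rw [ENNReal.ofReal_mul (Real.exp_pos _).le, mul_comm]
            congr 1
            rw [ENNReal.ofReal_pow (by norm_num)]
            simp
    have h5 := (lintegral_mono (μ := Measure.pi fun _ : Fin n => μ.prod μ) hpt).trans_eq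
      (lintegral_const _)
    rw [← havg, measure_univ, mul_one] at h5
    exact (ENNReal.mul_le_mul_iff_right (by simp) (by simp)).1 h5
  have hfin := hmarkov.trans hsym
  refine (measure_mono hsub).trans ?_
  have hpos : 0 < Real.exp (t * (n * (D + t))) := Real.exp_pos _
  rw [mul_comm, ← ENNReal.le_div_iff_mul_le (Or.inl (by simpa using hpos)) (Or.inl ENNReal.ofReal_ne_top),
    ← ENNReal.ofReal_div_of_pos hpos, ← Real.exp_sub] at hfin
  refine hfin.trans (le_of_eq ?_)
  congr 2
  ring

/-! ### Coverings of linear maps -/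

section Greedy

variable {E : Type*} [NormedAddCommGroup E] [InnerProductSpace ℝ E]

/-- Greedy approximation of a vector by a signed sum of few sample points, uniformly as a linear
functional on the sample. -/
theorem exists_greedy_approximation {Y : Type*} [Nonempty Y] (x : Y → E) {b ε : ℝ} (hb : 0 < b)
    (hε : 0 < ε) (hx : ∀ y, ‖x y‖ ≤ b) :
    ∀ (κ : ℕ) (v : E), ‖v‖ ^ 2 * b ^ 2 < (κ + 1) * ε ^ 2 →
      ∃ c : Fin κ → Y × SignType, ∀ y,
        |inner ℝ (v - (ε / b ^ 2) • ∑ r, ((c r).2 : ℝ) • x (c r).1) (x y)| ≤ ε := by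
  intro κ
  induction κ with
  | zero =>
    intro v hv
    refine ⟨Fin.elim0, fun y => ?_⟩
    simp only [Finset.univ_eq_empty, Finset.sum_empty, smul_zero, sub_zero]
    have h1 : ‖v‖ * b < ε := by
      refine lt_of_pow_lt_pow_left₀ 2 hε.le ?_
      rw [mul_pow]
      simpa using hv
    exact (abs_real_inner_le_norm v (x y)).trans
      ((mul_le_mul_of_nonneg_left (hx y) (norm_nonneg v)).trans h1.le)
  | succ κ ih =>
    intro v hv
    by_cases h : ∀ y, |inner ℝ v (x y)| ≤ ε
    · refine ⟨fun _ => (Classical.arbitrary Y, 0), fun y => ?_⟩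
      simpa using h y
    · push Not at h
      obtain ⟨y, hy⟩ := h
      obtain ⟨s, hs2, hs⟩ : ∃ s : SignType, ((s : ℝ)) ^ 2 = 1 ∧ ε < (s : ℝ) * inner ℝ v (x y) := by
        rcases lt_abs.1 hy with h | h
        · exact ⟨1, by simp, by simpa using h⟩
        · exact ⟨-1, by simp, by simpa using h⟩
      set w := v - (ε / b ^ 2) • ((s : ℝ) • x y) with hw
      have hw2 : ‖w‖ ^ 2 * b ^ 2 < (κ + 1) * ε ^ 2 := by
        have e : ‖w‖ ^ 2 = ‖v‖ ^ 2 - 2 * (ε / b ^ 2) * ((s : ℝ) * inner ℝ v (x y)) +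
            (ε / b ^ 2) ^ 2 * ‖x y‖ ^ 2 := by
          rw [hw, norm_sub_sq_real, inner_smul_right, inner_smul_right, norm_smul, norm_smul,
            mul_pow, mul_pow, Real.norm_eq_abs, Real.norm_eq_abs, sq_abs, sq_abs, hs2]
          ring
        have h1 : ‖x y‖ ^ 2 ≤ b ^ 2 := pow_le_pow_left₀ (norm_nonneg _) (hx y) 2
        have h2 : (ε / b ^ 2) ^ 2 * ‖x y‖ ^ 2 ≤ (ε / b ^ 2) ^ 2 * b ^ 2 := by gcongr
        have h3 : 2 * (ε / b ^ 2) * ε ≤ 2 * (ε / b ^ 2) * ((s : ℝ) * inner ℝ v (x y)) := by gcongr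
        have h4 : ‖w‖ ^ 2 ≤ ‖v‖ ^ 2 - ε ^ 2 / b ^ 2 := by
          have : (ε / b ^ 2) ^ 2 * b ^ 2 = ε ^ 2 / b ^ 2 := by field_simp
          have : 2 * (ε / b ^ 2) * ε = 2 * (ε ^ 2 / b ^ 2) := by ring
          linarith
        calc ‖w‖ ^ 2 * b ^ 2 ≤ (‖v‖ ^ 2 - ε ^ 2 / b ^ 2) * b ^ 2 := by gcongr
          _ = ‖v‖ ^ 2 * b ^ 2 - ε ^ 2 := by field_simp
          _ < _ := by push_cast at hv; linarith
      obtain ⟨c, hc⟩ := ih w hw2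
      refine ⟨Fin.cons (y, s) c, fun y' => ?_⟩
      have := hc y'
      rw [Fin.sum_univ_succ]
      simp only [Fin.cons_zero, Fin.cons_succ]
      rwa [smul_add, ← sub_sub, ← hw]

end Greedy

/-- The number of sample points used for a row of the given norm. -/
noncomputable def rowBudget (a : ℝ) (k : ℕ) (r : ℝ) : ℕ := ⌊k * r / a⌋₊

/-- A covering of the matrices with bounded `(2,1)`-norm, uniform for a finite sample. -/
theorem exists_matrix_cover {E : Type*} [NormedAddCommGroup E] [InnerProductSpace ℝ E]
    {Y J : Type*} [Fintype Y] [Fintype J] [Nonempty Y] (x : Y → E) {a b : ℝ}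
    (ha : 0 < a) (hb : 0 < b) (hx : ∀ y, ‖x y‖ ≤ b) (k : ℕ) :
    ∃ N : Finset (J → E), N.card ≤ (3 * Fintype.card J * Fintype.card Y + 1) ^ k ∧
      ∀ A : J → E, ∑ j, ‖A j‖ ≤ a → ∃ U ∈ N, ∃ e : J → ℝ, (∀ j, 0 ≤ e j) ∧
        (∑ j, e j ^ 2 ≤ if k = 0 then (a * b) ^ 2 else 2 / k * (a * b) ^ 2) ∧
        ∀ j y, |inner ℝ (A j - U j) (x y)| ≤ e j := by
  classical
  have hbase : ∀ (A : J → E) j y, |inner ℝ (A j) (x y)| ≤ ‖A j‖ * b := fun A j y =>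
    (abs_real_inner_le_norm _ _).trans (mul_le_mul_of_nonneg_left (hx y) (norm_nonneg _))
  rcases Nat.eq_zero_or_pos k with rfl | hk
  · refine ⟨{0}, by simp, fun A hA => ⟨0, by simp, fun j => ‖A j‖ * b, fun j => by positivity, ?_,
      fun j y => by simpa using hbase A j y⟩⟩
    simp only [if_true, mul_pow, ← Finset.sum_mul]
    gcongr
    refine (Finset.sum_sq_le_sq_sum_of_nonneg fun j _ => norm_nonneg _).trans ?_
    gcongr
  have hk' : (0 : ℝ) < k := by exact_mod_cast hk
  set ε : ℕ → ℝ := fun κ => a * b * Real.sqrt (κ + 1) / k with hε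
  have hεpos : ∀ κ, 0 < ε κ := fun κ => by
    have : 0 < Real.sqrt ((κ : ℝ) + 1) := Real.sqrt_pos.2 (by positivity)
    positivity
  have hε2 : ∀ κ, ε κ ^ 2 = (a * b) ^ 2 * (κ + 1) / k ^ 2 := fun κ => by
    rw [hε]
    simp only [div_pow, mul_pow]
    rw [Real.sq_sqrt (by positivity)]
  let contrib : Option (J × Y × SignType) → J → E := fun q j =>
    match q with
    | none => 0
    | some p => if p.1 = j then (p.2.2 : ℝ) • x p.2.1 else 0
  let cnt : (Fin k → Option (J × Y × SignType)) → J → ℕ := fun c j =>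
    (Finset.univ.filter fun i => ∃ p, c i = some p ∧ p.1 = j).card
  let dec : (Fin k → Option (J × Y × SignType)) → J → E := fun c j =>
    (ε (cnt c j) / b ^ 2) • ∑ i, contrib (c i) j
  refine ⟨Finset.univ.image dec, ?_, ?_⟩
  · refine Finset.card_image_le.trans (le_of_eq ?_)
    rw [Finset.card_univ, Fintype.card_fun, Fintype.card_fin, Fintype.card_option,
      Fintype.card_prod, Fintype.card_prod]
    have : Fintype.card SignType = 3 := rfl
    rw [this]
    congr 2
    ring
  intro A hA
  set κ : J → ℕ := fun j => rowBudget a k ‖A j‖ with hκ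
  have hκle : ∀ j, (κ j : ℝ) ≤ k * ‖A j‖ / a := fun j => Nat.floor_le (by positivity)
  have hκlt : ∀ j, k * ‖A j‖ / a < κ j + 1 := fun j => Nat.lt_floor_add_one _
  have hκsum : ∑ j, κ j ≤ k := by
    have : ((∑ j, κ j : ℕ) : ℝ) ≤ k := by
      push_cast
      calc ∑ j, (κ j : ℝ) ≤ ∑ j, k * ‖A j‖ / a := Finset.sum_le_sum fun j _ => hκle j
        _ = k * (∑ j, ‖A j‖) / a := by rw [Finset.mul_sum, Finset.sum_div]
        _ ≤ k * a / a := by gcongr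
        _ = k := by field_simp
    exact_mod_cast this
  have hrow : ∀ j, ∃ c : Fin (κ j) → Y × SignType, ∀ y,
      |inner ℝ (A j - (ε (κ j) / b ^ 2) • ∑ r, ((c r).2 : ℝ) • x (c r).1) (x y)| ≤ ε (κ j) := by
    intro j
    refine exists_greedy_approximation x hb (hεpos _) hx _ _ ?_
    rw [hε2]
    have h1 : ‖A j‖ < (κ j + 1) * a / k := by
      have := hκlt j
      rw [div_lt_iff₀ ha] at this
      rw [lt_div_iff₀ hk']
      linarith
    have h2 : ‖A j‖ ^ 2 < ((κ j + 1) * a / k) ^ 2 := pow_lt_pow_left₀ h1 (norm_nonneg _) two_ne_zero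
    calc ‖A j‖ ^ 2 * b ^ 2 < ((κ j + 1) * a / k) ^ 2 * b ^ 2 := by gcongr
      _ = _ := by ring
  choose c hc using hrow
  obtain ⟨emb⟩ : Nonempty ((Σ j, Fin (κ j)) ↪ Fin k) :=
    Function.Embedding.nonempty_of_card_le (by simpa using hκsum)
  set C : Fin k → Option (J × Y × SignType) :=
    Function.extend emb (fun p => some (p.1, c p.1 p.2)) fun _ => none with hC
  have hCemb : ∀ p, C (emb p) = some (p.1, c p.1 p.2) := fun p => emb.injective.extend_apply _ _ _
  have hCnone : ∀ i, (¬ ∃ p, emb p = i) → C i = none := fun i h => Function.extend_apply' _ _ _ h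
  have hcnt : ∀ j, cnt C j = κ j := by
    intro j
    have : (Finset.univ.filter fun i => ∃ p, C i = some p ∧ p.1 = j) =
        Finset.univ.map ⟨fun r : Fin (κ j) => emb ⟨j, r⟩, fun r r' h => by
          simpa using emb.injective h⟩ := by
      ext i
      simp only [Finset.mem_filter, Finset.mem_univ, true_and, Finset.mem_map]
      constructor
      · rintro ⟨p, hp, hpj⟩
        by_cases h : ∃ q, emb q = i
        · obtain ⟨⟨j', r⟩, rfl⟩ := h
          rw [hCemb] at hp
          cases hp
          subst hpj
          exact ⟨r, rfl⟩
        · rw [hCnone i h] at hp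
          cases hp
      · rintro ⟨r, rfl⟩
        exact ⟨_, hCemb _, rfl⟩
    simp only [cnt, this, Finset.card_map, Finset.card_univ, Fintype.card_fin]
  have hsum : ∀ j, ∑ i, contrib (C i) j = ∑ r, ((c j r).2 : ℝ) • x (c j r).1 := by
    intro j
    symm
    refine Finset.sum_of_injOn (fun r => emb ⟨j, r⟩) (fun r _ r' _ h => by simpa using emb.injective h)
      (fun _ _ => Finset.mem_coe.2 (Finset.mem_univ _)) ?_ ?_
    · intro i _ hi
      by_cases h : ∃ q, emb q = i
      · obtain ⟨⟨j', r⟩, rfl⟩ := h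
        rw [hCemb]
        have : j' ≠ j := by
          rintro rfl
          exact hi ⟨r, by simp, rfl⟩
        simp [contrib, this]
      · rw [hCnone i h]
    · intro r _
      simp only [hCemb, contrib, if_true]
  have hdec : ∀ j, dec C j = (ε (κ j) / b ^ 2) • ∑ r, ((c j r).2 : ℝ) • x (c j r).1 := by
    intro j
    simp only [dec, hcnt, hsum]
  refine ⟨dec C, Finset.mem_image_of_mem _ (Finset.mem_univ _),
    fun j => if κ j = 0 then ‖A j‖ * b else ε (κ j), fun j => ?_, ?_, fun j y => ?_⟩
  · dsimp only
    split_ifs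
    · positivity
    · exact (hεpos _).le
  · rw [if_neg hk.ne']
    have hj : ∀ j, (if κ j = 0 then ‖A j‖ * b else ε (κ j)) ^ 2 ≤ 2 / k * (a * b ^ 2) * ‖A j‖ := by
      intro j
      split_ifs with h
      · have h1 := hκlt j
        rw [h, div_lt_iff₀ ha] at h1
        have h2 : ‖A j‖ ≤ a / k := by
          rw [le_div_iff₀ hk']
          push_cast at h1
          linarith
        calc (‖A j‖ * b) ^ 2 = ‖A j‖ * ‖A j‖ * b ^ 2 := by ring
          _ ≤ a / k * ‖A j‖ * b ^ 2 := by gcongr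
          _ = 1 / k * (a * b ^ 2) * ‖A j‖ := by ring
          _ ≤ _ := by gcongr; norm_num
      · rw [hε2]
        have h1 : (κ j : ℝ) + 1 ≤ 2 * (k * ‖A j‖ / a) := by
          have : (1 : ℝ) ≤ κ j := by exact_mod_cast Nat.one_le_iff_ne_zero.2 h
          linarith [hκle j]
        calc (a * b) ^ 2 * (κ j + 1) / k ^ 2 ≤ (a * b) ^ 2 * (2 * (k * ‖A j‖ / a)) / k ^ 2 := by gcongr
          _ = _ := by field_simp
    refine (Finset.sum_le_sum fun j _ => hj j).trans ?_
    rw [← Finset.mul_sum]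
    calc 2 / k * (a * b ^ 2) * ∑ j, ‖A j‖ ≤ 2 / k * (a * b ^ 2) * a := by gcongr
      _ = _ := by ring
  · rw [hdec]
    dsimp only
    split_ifs with h
    · have : IsEmpty (Fin (κ j)) := by rw [h]; infer_instance
      simpa using hbase A j y
    · exact hc j y

/-! ### Perturbation of the network -/

/-- The Euclidean norm of a real vector. -/
noncomputable def l2 {ι : Type*} [Fintype ι] (x : ι → ℝ) : ℝ := Real.sqrt (∑ i, x i ^ 2)

section l2

variable {ι : Type*} [Fintype ι]

theorem l2_eq_norm (x : ι → ℝ) : l2 x = ‖(WithLp.toLp 2 x : EuclideanSpace ℝ ι)‖ := by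
  simp [l2, EuclideanSpace.norm_eq]

theorem l2_nonneg (x : ι → ℝ) : 0 ≤ l2 x := Real.sqrt_nonneg _

theorem l2_add_le (x y : ι → ℝ) : l2 (x + y) ≤ l2 x + l2 y := by
  simp only [l2_eq_norm, WithLp.toLp_add]
  exact norm_add_le _ _

theorem l2_sub_comm (x y : ι → ℝ) : l2 (x - y) = l2 (y - x) := by
  simp only [l2_eq_norm, WithLp.toLp_sub]
  exact norm_sub_rev _ _

theorem l2_sq (x : ι → ℝ) : l2 x ^ 2 = ∑ i, x i ^ 2 :=
  Real.sq_sqrt (Finset.sum_nonneg fun _ _ => sq_nonneg _)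

theorem abs_le_l2 (x : ι → ℝ) (i : ι) : |x i| ≤ l2 x := by
  refine Real.le_sqrt_of_sq_le ?_
  rw [sq_abs]
  exact Finset.single_le_sum (f := fun i => x i ^ 2) (fun _ _ => sq_nonneg _) (Finset.mem_univ i)

theorem l2_comp_le {κ : Type*} [Fintype κ] (x : ι → ℝ) {φ : κ → ι} (hφ : Function.Injective φ) :
    l2 (fun k => x (φ k)) ≤ l2 x := by
  classical
  refine Real.sqrt_le_sqrt ?_
  rw [← Finset.sum_image (f := fun i => x i ^ 2) (s := Finset.univ) (g := φ) (hφ.injOn)]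
  exact Finset.sum_le_sum_of_subset_of_nonneg (Finset.subset_univ _) fun _ _ _ => sq_nonneg _

theorem abs_sum_mul_le_l2 (x y : ι → ℝ) : |∑ i, x i * y i| ≤ l2 x * l2 y := by
  rw [← Real.sqrt_sq_eq_abs, l2, l2, ← Real.sqrt_mul (Finset.sum_nonneg fun _ _ => sq_nonneg _)]
  exact Real.sqrt_le_sqrt (Finset.sum_mul_sq_le_sq_mul_sq _ _ _)

end l2

namespace ConvArch

variable {L : ℕ} (net : ConvArch L)

theorem patchNorm_eq (l : ℕ) (x : net.Act l) :
    net.patchNorm l x = ⨆ o, l2 fun i => x (net.patch l o i) := rfl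

theorem l2_patch_le_patchNorm (l : ℕ) (x : net.Act l) (o : Fin (net.O l)) :
    l2 (fun i => x (net.patch l o i)) ≤ net.patchNorm l x :=
  le_ciSup (f := fun o => l2 fun i => x (net.patch l o i)) (Set.finite_range _).bddAbove o

theorem patchNorm_le_add {l : ℕ} (hl : l < L) (x y : net.Act l) :
    net.patchNorm l x ≤ net.patchNorm l y + l2 (x - y) := by
  have : Nonempty (Fin (net.O l)) := ⟨⟨0, net.O_pos l hl⟩⟩
  rw [patchNorm_eq]
  refine ciSup_le fun o => ?_
  have h1 := l2_add_le (fun i => y (net.patch l o i)) (fun i => (x - y) (net.patch l o i))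
  have h2 : ((fun i => y (net.patch l o i)) + fun i => (x - y) (net.patch l o i)) =
      fun i => x (net.patch l o i) := by
    funext i; simp
  rw [h2] at h1
  exact h1.trans (add_le_add (net.l2_patch_le_patchNorm l y o)
    (l2_comp_le (x - y) (net.patch_injective l hl o)))

theorem abs_patchNorm_sub_le {l : ℕ} (hl : l < L) (x y : net.Act l) :
    |net.patchNorm l x - net.patchNorm l y| ≤ l2 (x - y) := by
  rw [abs_le]
  have h1 := net.patchNorm_le_add hl x y
  have h2 := net.patchNorm_le_add hl y x
  rw [l2_sub_comm] at h2
  constructor <;> linarith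

theorem dist21_nonneg (l : ℕ) (A M : net.Wt l) : 0 ≤ net.dist21 l A M :=
  Finset.sum_nonneg fun _ _ => Real.sqrt_nonneg _

open scoped Matrix.Norms.L2Operator in
theorem sigmaPrime_nonneg (l : ℕ) (A : net.Wt l) : 0 ≤ net.sigmaPrime l A := by
  rw [sigmaPrime]
  split_ifs
  · exact Real.iSup_nonneg fun _ => Real.sqrt_nonneg _
  · exact Real.iSup_nonneg fun _ => norm_nonneg _

theorem abs_G_sub_le {l : ℕ} (hl : l < L) {z z' : Fin (net.m (l + 1)) × Fin (net.O l) → ℝ} {c : ℝ}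
    (hc : 0 ≤ c) (h : ∀ q, |z q - z' q| ≤ c) (p : Fin (net.U (l + 1)) × Fin (net.w (l + 1))) :
    |net.G l z p - net.G l z' p| ≤ net.ρ l * c := by
  have h1 := (net.G_lipschitz l hl).dist_le_mul z z'
  have h2 := dist_le_pi_dist (net.G l z) (net.G l z') p
  rw [Real.dist_eq] at h2
  refine h2.trans (h1.trans ?_)
  gcongr
  exact (dist_pi_le_iff hc).2 fun q => by rw [Real.dist_eq]; exact h q

/-- A hidden neuron is controlled by one pre-activation of its window. -/
theorem exists_selection {l : ℕ} (hl : l + 1 < L)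
    (z z' : Fin (net.m (l + 1)) × Fin (net.O l) → ℝ) :
    ∃ sel : net.Selection l, (∀ p, |net.G l z p.1 - net.G l z' p.1| ≤
        net.ρ l * |z (sel p).1 - z' (sel p).1|) ∧
      ∀ p, ¬ (net.window l p).Nonempty → net.G l z p = net.G l z' p := by
  classical
  have key : ∀ p : {p // (net.window l p).Nonempty}, ∃ q : {q // q ∈ net.window l p.1},
      |net.G l z p.1 - net.G l z' p.1| ≤ net.ρ l * |z q.1 - z' q.1| := by
    rintro ⟨p, hp⟩
    obtain ⟨q, hq, hmax⟩ := Finset.exists_max_image (net.window l p) (fun q => |z q - z' q|) hp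
    refine ⟨⟨q, hq⟩, ?_⟩
    set z'' : Fin (net.m (l + 1)) × Fin (net.O l) → ℝ :=
      fun r => if r ∈ net.window l p then z' r else z r with hz''
    rw [net.G_local l hl p z' z'' fun r hr => by simp [hz'', hr]]
    refine net.abs_G_sub_le (by omega) (abs_nonneg _) (fun r => ?_) p
    by_cases hr : r ∈ net.window l p
    · simpa [hz'', hr] using hmax r hr
    · simp [hz'', hr]
  choose sel hsel using key
  refine ⟨sel, hsel, fun p hp => net.G_local l hl p z z' fun q hq => absurd ⟨q, hq⟩ hp⟩

theorem sum_G_sub_sq_le {l : ℕ} {z z' : Fin (net.m (l + 1)) × Fin (net.O l) → ℝ}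
    {sel : net.Selection l} (h1 : ∀ p, |net.G l z p.1 - net.G l z' p.1| ≤
        net.ρ l * |z (sel p).1 - z' (sel p).1|)
    (h2 : ∀ p, ¬ (net.window l p).Nonempty → net.G l z p = net.G l z' p) :
    ∑ p, (net.G l z - net.G l z') p ^ 2 ≤
      (net.ρ l : ℝ) ^ 2 * ∑ p, (z (sel p).1 - z' (sel p).1) ^ 2 := by
  classical
  have e : ∑ p, (net.G l z - net.G l z') p ^ 2 =
      ∑ p : {p // (net.window l p).Nonempty}, (net.G l z p.1 - net.G l z' p.1) ^ 2 := by
    rw [← Finset.sum_subtype (Finset.univ.filter fun p => (net.window l p).Nonempty) (by simp)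
      (fun p => (net.G l z p - net.G l z' p) ^ 2), Finset.sum_filter_of_ne]
    · rfl
    · intro p _ hp
      by_contra hne
      exact hp (by rw [h2 p hne, sub_self]; norm_num)
  rw [e, Finset.mul_sum]
  refine Finset.sum_le_sum fun p _ => ?_
  rw [← sq_abs, ← sq_abs (z _ - _), ← mul_pow]
  exact pow_le_pow_left₀ (abs_nonneg _) (h1 p) 2

/-- Effect on a hidden layer of a perturbation of the pre-activations which is controlled filter by
filter. -/
theorem l2_G_sub_le_of_filterwise {l : ℕ} (hl : l + 1 < L)
    {z z' : Fin (net.m (l + 1)) × Fin (net.O l) → ℝ} {e : Fin (net.m (l + 1)) → ℝ}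
    (h : ∀ q, |z q - z' q| ≤ e q.1) :
    l2 (net.G l z - net.G l z') ≤ net.ρ l * Real.sqrt (net.w (l + 1)) * l2 e := by
  classical
  obtain ⟨sel, h1, h2⟩ := net.exists_selection hl z z'
  have h3 := net.sum_G_sub_sq_le h1 h2
  refine Real.sqrt_le_iff.2 ⟨by have := l2_nonneg e; positivity, h3.trans ?_⟩
  rw [mul_pow, mul_pow, Real.sq_sqrt (by positivity), l2_sq, mul_assoc]
  gcongr
  set φ : {p // (net.window l p).Nonempty} → Fin (net.m (l + 1)) × Fin (net.w (l + 1)) :=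
    fun p => ((sel p).1.1, p.1.2) with hφ
  have hinj : Function.Injective φ := by
    rintro p p' hpp
    simp only [hφ, Prod.mk.injEq] at hpp
    have := net.window_channel l hl p.1 p'.1 _ _ (sel p).2 (sel p').2 hpp.1
    exact Subtype.ext (Prod.ext this hpp.2)
  calc ∑ p, (z (sel p).1 - z' (sel p).1) ^ 2 ≤ ∑ p, e (φ p).1 ^ 2 := by
        refine Finset.sum_le_sum fun p _ => ?_
        rw [← sq_abs]
        exact pow_le_pow_left₀ (abs_nonneg _) (h _) 2
    _ = ∑ r ∈ Finset.univ.image φ, e r.1 ^ 2 := by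
        rw [Finset.sum_image hinj.injOn]
    _ ≤ ∑ r : Fin (net.m (l + 1)) × Fin (net.w (l + 1)), e r.1 ^ 2 :=
        Finset.sum_le_sum_of_subset_of_nonneg (Finset.subset_univ _) fun _ _ _ => sq_nonneg _
    _ = net.w (l + 1) * ∑ j, e j ^ 2 := by
        rw [Fintype.sum_prod_type]
        simp [Finset.mul_sum]

open scoped Matrix.Norms.L2Operator in
/-- A hidden layer is Lipschitz for the Euclidean norm. -/
theorem l2_G_conv_sub_le {l : ℕ} (hl : l + 1 < L) (A : net.Wt l) (x x' : net.Act l) :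
    l2 (net.G l (net.conv l A x) - net.G l (net.conv l A x')) ≤
      net.ρ l * net.sigmaPrime l A * l2 (x - x') := by
  classical
  obtain ⟨sel, h1, h2⟩ := net.exists_selection hl (net.conv l A x) (net.conv l A x')
  have h3 := net.sum_G_sub_sq_le h1 h2
  have hσ := net.sigmaPrime_nonneg l A
  have hx := l2_nonneg (x - x')
  refine Real.sqrt_le_iff.2 ⟨by positivity, h3.trans ?_⟩
  rw [mul_assoc, mul_pow]
  gcongr
  set S := (net.convMatrix l A).submatrix (fun p => (sel p).1) id with hS
  have e1 : ∀ p, net.conv l A x (sel p).1 - net.conv l A x' (sel p).1 = S.mulVec (x - x') p := by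
    intro p
    rw [← net.convMatrix_mulVec, ← net.convMatrix_mulVec, ← Pi.sub_apply, ← Matrix.mulVec_sub]
    rfl
  have e2 : l2 (S.mulVec (x - x')) ≤ ‖S‖ * l2 (x - x') := by
    rw [l2_eq_norm, l2_eq_norm]
    exact Matrix.l2_opNorm_mulVec S (WithLp.toLp 2 (x - x'))
  have e3 : ‖S‖ ≤ net.sigmaPrime l A := by
    rw [sigmaPrime, if_neg (by omega)]
    exact le_ciSup (f := fun sel : net.Selection l =>
      ‖(net.convMatrix l A).submatrix (fun p => (sel p).1) id‖) (Set.finite_range _).bddAbove sel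
  calc ∑ p, (net.conv l A x (sel p).1 - net.conv l A x' (sel p).1) ^ 2
      = l2 (S.mulVec (x - x')) ^ 2 := by
        rw [l2_sq]
        exact Finset.sum_congr rfl fun p _ => by rw [e1]
    _ ≤ _ := pow_le_pow_left₀ (l2_nonneg _) (e2.trans (by gcongr)) 2

/-- The last layer is Lipschitz from the Euclidean to the sup norm. -/
theorem abs_G_conv_last_sub_le {l : ℕ} (hl : l + 1 = L) (A : net.Wt l) (x x' : net.Act l)
    (p : Fin (net.U (l + 1)) × Fin (net.w (l + 1))) :
    |net.G l (net.conv l A x) p - net.G l (net.conv l A x') p| ≤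
      net.ρ l * net.sigmaPrime l A * l2 (x - x') := by
  have hσ := net.sigmaPrime_nonneg l A
  have hx := l2_nonneg (x - x')
  rw [mul_assoc]
  refine net.abs_G_sub_le (by omega) (by positivity) (fun q => ?_) p
  have e : net.conv l A x q - net.conv l A x' q =
      ∑ i, (x - x') (net.patch l q.2 i) * A q.1 i := by
    simp only [conv, ← Finset.sum_sub_distrib, Pi.sub_apply, sub_mul]
  rw [e]
  refine (abs_sum_mul_le_l2 (fun i => (x - x') (net.patch l q.2 i)) (A q.1)).trans ?_
  rw [mul_comm]
  have h1 : l2 (A q.1) ≤ net.sigmaPrime l A := by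
    rw [sigmaPrime, if_pos hl]
    exact le_ciSup (f := fun j => l2 (A j)) (Set.finite_range _).bddAbove q.1
  exact mul_le_mul h1 (l2_comp_le _ (net.patch_injective l (by omega) _)) (l2_nonneg _) hσ

/-- On the input `x`, the weights `A'` are an approximation of `A` of precision `ε` at layer `l`,
filter by filter. -/
def Approx (A A' : ∀ l, net.Wt l) (l : ℕ) (x : net.Act 0) (ε : ℝ) : Prop :=
  ∃ e : Fin (net.m (l + 1)) → ℝ, l2 e ≤ ε ∧ ∀ q,
    |net.conv l (A' l) (net.F A' l x) q - net.conv l (A l) (net.F A' l x) q| ≤ e q.1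

/-- The accumulated error at layer `l`, for precisions `ε` and spectral bounds `s`. -/
noncomputable def accError (s ε : ℕ → ℝ) (l : ℕ) : ℝ :=
  ∑ i ∈ Finset.range l, net.ρ i * Real.sqrt (net.w (i + 1)) *
    (∏ j ∈ Finset.Ico (i + 1) l, (net.ρ j : ℝ) * s j) * ε i

theorem accError_succ (s ε : ℕ → ℝ) (l : ℕ) :
    net.accError s ε (l + 1) =
      net.ρ l * Real.sqrt (net.w (l + 1)) * ε l + net.ρ l * s l * net.accError s ε l := by
  rw [accError, Finset.sum_range_succ, Finset.Ico_self, Finset.prod_empty, mul_one, add_comm,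
    accError, Finset.mul_sum]
  congr 1
  refine Finset.sum_congr rfl fun i hi => ?_
  rw [Finset.prod_Ico_succ_top (by have := Finset.mem_range.1 hi; omega)]
  ring

theorem l2_F_sub_le {A A' : ∀ l, net.Wt l} {s ε : ℕ → ℝ} (x : net.Act 0)
    (hs : ∀ l, l < L → net.sigmaPrime l (A l) ≤ s l) :
    ∀ l, l < L → (∀ i, i < l → net.Approx A A' i x (ε i)) →
      l2 (net.F A' l x - net.F A l x) ≤ net.accError s ε l := by
  intro l
  induction l with
  | zero =>
    intro _ _
    simp [F, l2, accError]
  | succ l ih =>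
    intro hl happ
    have h1 := ih (by omega) fun i hi => happ i (by omega)
    obtain ⟨e, he, heq⟩ := happ l (by omega)
    rw [accError_succ]
    have h2 := net.l2_G_sub_le_of_filterwise hl heq
    have h3 := net.l2_G_conv_sub_le hl (A l) (net.F A' l x) (net.F A l x)
    have h4 := l2_add_le
      (net.G l (net.conv l (A' l) (net.F A' l x)) - net.G l (net.conv l (A l) (net.F A' l x)))
      (net.G l (net.conv l (A l) (net.F A' l x)) - net.G l (net.conv l (A l) (net.F A l x)))
    rw [sub_add_sub_cancel] at h4
    have hσ := net.sigmaPrime_nonneg l (A l)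
    refine h4.trans (add_le_add (h2.trans (by gcongr)) (h3.trans ?_))
    have hs0 := hσ.trans (hs l (by omega))
    have := hs l (by omega)
    have := l2_nonneg (net.F A' l x - net.F A l x)
    gcongr

theorem abs_F_last_sub_le (hfc : net.LastFullyConnected) (hL : 0 < L) {A A' : ∀ l, net.Wt l}
    {s ε : ℕ → ℝ} (x : net.Act 0) (hs : ∀ l, l < L → net.sigmaPrime l (A l) ≤ s l)
    (happ : ∀ i, i < L → net.Approx A A' i x (ε i)) (p : Fin (net.U L) × Fin (net.w L)) :
    |net.F A' L x p - net.F A L x p| ≤ net.accError s ε L := by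
  obtain ⟨l, rfl⟩ : ∃ l, L = l + 1 := ⟨L - 1, by omega⟩
  have h1 := net.l2_F_sub_le (ε := ε) x hs l (by omega) fun i hi => happ i (by omega)
  obtain ⟨e, he, heq⟩ := happ l (by omega)
  rw [accError_succ, hfc.1]
  have h2 := net.abs_G_sub_le (by omega) (l2_nonneg e)
    (fun q => (heq q).trans ((le_abs_self _).trans (abs_le_l2 e q.1))) p
  have h3 := net.abs_G_conv_last_sub_le rfl (A l) (net.F A' l x) (net.F A l x) p
  have hσ := net.sigmaPrime_nonneg l (A l)
  have hs0 := hσ.trans (hs l (by omega))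
  have := hs l (by omega)
  have := l2_nonneg (net.F A' l x - net.F A l x)
  calc |net.F A' (l + 1) x p - net.F A (l + 1) x p|
      ≤ |net.G l (net.conv l (A' l) (net.F A' l x)) p - net.G l (net.conv l (A l) (net.F A' l x)) p|
        + |net.G l (net.conv l (A l) (net.F A' l x)) p - net.G l (net.conv l (A l) (net.F A l x)) p| :=
        abs_sub_le _ _ _
    _ ≤ _ := by
        refine add_le_add (h2.trans ?_) (h3.trans ?_)
        · simp only [Nat.cast_one, Real.sqrt_one, mul_one]
          gcongr
        · gcongr

end ConvArch

namespace ConvArch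

variable {L : ℕ} (net : ConvArch L)

/-! ### Finite nets of weights -/

/-- The relative precision reached with `k` sample points. -/
noncomputable def precision (k : ℕ) : ℝ := if k = 0 then 1 else Real.sqrt (2 / k)

theorem precision_nonneg (k : ℕ) : 0 ≤ precision k := by
  rw [precision]
  split_ifs
  · exact zero_le_one
  · exact Real.sqrt_nonneg _

theorem F_congr {A A' : ∀ l, net.Wt l} {l : ℕ} (h : ∀ i, i < l → A i = A' i) :
    net.F A l = net.F A' l := by
  induction l with
  | zero => rfl
  | succ l ih =>
    funext x
    simp only [F]
    rw [ih fun i hi => h i (by omega), h l (by omega)]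

theorem F_update (A : ∀ l, net.Wt l) {l i : ℕ} (U : net.Wt l) (hi : i ≤ l) :
    net.F (Function.update A l U) i = net.F A i :=
  net.F_congr fun j hj => Function.update_of_ne (by omega) _ _

/-- The covering of the weights of one layer. -/
theorem exists_layer_net {T : Type*} [Fintype T] [Nonempty T] {l : ℕ} (hl : l < L)
    (g : T → net.Act l) (M : net.Wt l) {a b : ℝ} (ha : 0 < a) (hb : 0 < b) (k : ℕ) :
    ∃ N : Finset (net.Wt l),
      N.card ≤ (3 * net.m (l + 1) * (Fintype.card T * net.O l) + 1) ^ k ∧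
      ∀ A : net.Wt l, net.dist21 l A M ≤ a → ∃ U ∈ N, ∃ e : Fin (net.m (l + 1)) → ℝ,
        l2 e ≤ a * b * precision k ∧ ∀ t, net.patchNorm l (g t) ≤ b → ∀ q,
          |net.conv l U (g t) q - net.conv l A (g t) q| ≤ e q.1 := by
  classical
  have : Nonempty (Fin (net.O l)) := ⟨⟨0, net.O_pos l hl⟩⟩
  set x : T × Fin (net.O l) → EuclideanSpace ℝ (Fin (net.d (l + 1))) := fun y =>
    if net.patchNorm l (g y.1) ≤ b then WithLp.toLp 2 fun i => g y.1 (net.patch l y.2 i) else 0 with hxdef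
  have hx : ∀ y, ‖x y‖ ≤ b := by
    intro y
    simp only [hxdef]
    split_ifs with h
    · rw [← l2_eq_norm]
      exact (net.l2_patch_le_patchNorm l (g y.1) y.2).trans h
    · simpa using hb.le
  obtain ⟨N, hcard, hN⟩ := exists_matrix_cover (J := Fin (net.m (l + 1))) x ha hb hx k
  refine ⟨N.image fun U => M + Matrix.of fun j i => U j i, ?_, fun A hA => ?_⟩
  · refine Finset.card_image_le.trans (hcard.trans (le_of_eq ?_))
    simp
  obtain ⟨U, hU, e, he0, he, hUe⟩ := hN (fun j => WithLp.toLp 2 ((A - M) j)) (by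
    simp only [← l2_eq_norm]
    exact hA)
  refine ⟨_, Finset.mem_image_of_mem _ hU, e, ?_, fun t ht q => ?_⟩
  · refine Real.sqrt_le_iff.2 ⟨mul_nonneg (by positivity) (precision_nonneg k), he.trans (le_of_eq ?_)⟩
    rw [mul_pow _ (precision k), precision]
    split_ifs
    · simp
    · rw [Real.sq_sqrt (by positivity)]; ring
  · have h := hUe q.1 (t, q.2)
    simp only [hxdef, if_pos ht] at h
    rw [abs_sub_comm]
    convert h using 2
    simp only [conv, PiLp.inner_apply, ← Finset.sum_sub_distrib]
    refine Finset.sum_congr rfl fun i _ => ?_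
    simp
    ring

/-- The covering of the weights of the first layers. -/
theorem exists_net {T : Type*} [Fintype T] [Nonempty T] (x : T → net.Act 0) (M : ∀ l, net.Wt l)
    {a b : ℕ → ℝ} (ha : ∀ l, l < L → 0 < a l) (hb : ∀ l, l < L → 0 < b l) (k : ℕ → ℕ) :
    ∀ l, l ≤ L → ∃ N : Finset (∀ l, net.Wt l),
      N.card ≤ ∏ i ∈ Finset.range l, (3 * net.m (i + 1) * (Fintype.card T * net.O i) + 1) ^ k i ∧
      ∀ A : ∀ l, net.Wt l, (∀ i, i < L → net.dist21 i (A i) (M i) ≤ a i) → ∃ A' ∈ N,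
        ∀ i, i < l → ∀ t, net.patchNorm i (net.F A' i (x t)) ≤ b i →
          net.Approx A A' i (x t) (a i * b i * precision (k i)) := by
  classical
  intro l
  induction l with
  | zero =>
    intro _
    exact ⟨{M}, by simp, fun A _ => ⟨M, by simp, fun i hi => absurd hi (by omega)⟩⟩
  | succ l ih =>
    intro hl
    obtain ⟨N, hcard, hN⟩ := ih (by omega)
    choose S hScard hS using fun A' : ∀ l, net.Wt l =>
      net.exists_layer_net (l := l) (by omega) (fun t => net.F A' l (x t)) (M l) (ha l hl) (hb l hl)
        (k l)
    refine ⟨N.biUnion fun A' => (S A').image fun U => Function.update A' l U, ?_, fun A hA => ?_⟩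
    · rw [Finset.prod_range_succ]
      refine (Finset.card_biUnion_le_card_mul _ _ _ fun A' _ =>
        Finset.card_image_le.trans (hScard A')).trans ?_
      gcongr
    · obtain ⟨A', hA', happ⟩ := hN A hA
      obtain ⟨U, hU, e, he, hUe⟩ := hS A' (A l) (hA l hl)
      refine ⟨Function.update A' l U, Finset.mem_biUnion.2 ⟨A', hA', Finset.mem_image_of_mem _ hU⟩,
        fun i hi t ht => ?_⟩
      rw [net.F_update A' U (by omega)] at ht
      rcases Nat.lt_succ_iff_lt_or_eq.1 hi with h | h
      · obtain ⟨e', he', h'⟩ := happ i h t ht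
        refine ⟨e', he', ?_⟩
        rw [net.F_update A' U (by omega), Function.update_of_ne (by omega)]
        exact h'
      · subst h
        refine ⟨e, he, ?_⟩
        rw [net.F_update A' U le_rfl, Function.update_self]
        exact hUe t ht

/-! ### The loss -/

/-- The loss of the weights `A` before clamping to `[0, 1]`. -/
noncomputable def lossArg (A : ∀ l, net.Wt l) (γ : ℝ) (b : ℕ → ℝ)
    (p : net.Act 0 × Fin (net.U L)) : ℝ :=
  max (1 - net.margin A p.1 p.2 / γ) (⨆ l : Fin L, (net.patchNorm l (net.F A l p.1) / b l - 1))

/-- The loss of the weights `A`: it is `1` at misclassified points, and `0` at the points with margin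
at least `γ` and hidden activations bounded by `b`. -/
noncomputable def loss (A : ∀ l, net.Wt l) (γ : ℝ) (b : ℕ → ℝ)
    (p : net.Act 0 × Fin (net.U L)) : ℝ :=
  max 0 (min 1 (net.lossArg A γ b p))

theorem loss_nonneg (A : ∀ l, net.Wt l) (γ : ℝ) (b : ℕ → ℝ) (p) : 0 ≤ net.loss A γ b p :=
  le_max_left _ _

theorem loss_le_one (A : ∀ l, net.Wt l) (γ : ℝ) (b : ℕ → ℝ) (p) : net.loss A γ b p ≤ 1 :=
  max_le zero_le_one (min_le_left _ _)

theorem continuous_F (A : ∀ l, net.Wt l) : ∀ l, l ≤ L → Continuous (net.F A l) := by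
  intro l
  induction l with
  | zero => intro _; exact continuous_id
  | succ l ih =>
    intro hl
    have h1 := ih (by omega)
    have h2 := (net.G_lipschitz l (by omega)).continuous
    refine h2.comp ?_
    refine continuous_pi fun q => ?_
    simp only [conv]
    fun_prop

theorem continuous_finite_iSup {ι X : Type*} [Finite ι] [TopologicalSpace X] {f : ι → X → ℝ}
    (hf : ∀ i, Continuous (f i)) : Continuous fun x => ⨆ i, f i x := by
  rcases isEmpty_or_nonempty ι with h | h
  · simpa using continuous_const
  · have := Fintype.ofFinite ι
    have : (fun x => ⨆ i, f i x) = fun x => Finset.univ.sup' Finset.univ_nonempty fun i => f i x := by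
      funext x
      rw [Finset.sup'_univ_eq_ciSup]
    rw [this]
    exact Continuous.finset_sup'_apply _ fun i _ => hf i

theorem continuous_patchNorm (l : ℕ) : Continuous (net.patchNorm l) := by
  refine continuous_finite_iSup fun o => ?_
  fun_prop

theorem continuous_loss (A : ∀ l, net.Wt l) (γ : ℝ) (b : ℕ → ℝ) :
    Continuous (net.loss A γ b) := by
  refine continuous_prod_of_discrete_right.2 fun y => ?_
  have hF : ∀ l, l ≤ L → Continuous (net.F A l) := net.continuous_F A
  have hm : Continuous fun x => net.margin A x y := by
    have hs : ∀ c, Continuous fun x => net.score A x c := fun c =>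
      (continuous_apply _).comp (hF L le_rfl)
    exact (hs y).sub (continuous_finite_iSup fun j => hs j)
  have hp : Continuous fun x => ⨆ l : Fin L, (net.patchNorm l (net.F A l x) / b l - 1) :=
    continuous_finite_iSup fun l =>
      (((net.continuous_patchNorm l).comp (hF l l.2.le)).div_const _).sub continuous_const
  exact continuous_const.max (continuous_const.min
    ((continuous_const.sub (hm.div_const γ)).max hp))

theorem abs_loss_sub_le (hL : 0 < L) {A A' : ∀ l, net.Wt l} {γ : ℝ} {b : ℕ → ℝ}
    {p : net.Act 0 × Fin (net.U L)} {η : ℝ} (hγ : 0 < γ) (hb : ∀ l, l < L → 0 < b l)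
    (h1 : |net.margin A' p.1 p.2 - net.margin A p.1 p.2| ≤ η * γ)
    (h2 : ∀ l, l < L →
      |net.patchNorm l (net.F A' l p.1) - net.patchNorm l (net.F A l p.1)| ≤ η * b l) :
    |net.loss A γ b p - net.loss A' γ b p| ≤ η := by
  have : Nonempty (Fin L) := ⟨⟨0, hL⟩⟩
  have harg : |net.lossArg A γ b p - net.lossArg A' γ b p| ≤ η := by
    rw [lossArg, lossArg]
    refine (abs_max_sub_max_le_max _ _ _ _).trans (max_le ?_ ?_)
    · have : 1 - net.margin A p.1 p.2 / γ - (1 - net.margin A' p.1 p.2 / γ) =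
        (net.margin A' p.1 p.2 - net.margin A p.1 p.2) / γ := by ring
      rw [this, abs_div, abs_of_pos hγ, div_le_iff₀ hγ]
      exact h1
    · have key : ∀ A A' : ∀ l, net.Wt l, (∀ l, l < L →
          |net.patchNorm l (net.F A' l p.1) - net.patchNorm l (net.F A l p.1)| ≤ η * b l) →
          (⨆ l : Fin L, (net.patchNorm l (net.F A l p.1) / b l - 1)) ≤
          (⨆ l : Fin L, (net.patchNorm l (net.F A' l p.1) / b l - 1)) + η := by
        intro A A' h
        refine ciSup_le fun l => ?_
        have h3 := le_ciSup (f := fun l : Fin L => net.patchNorm l (net.F A' l p.1) / b l - 1)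
          (Set.finite_range _).bddAbove l
        have h4 := (abs_le.1 (h l l.2)).1
        have h5 : net.patchNorm l (net.F A l p.1) / b l ≤ net.patchNorm l (net.F A' l p.1) / b l + η := by
          rw [div_add' _ _ _ (hb l l.2).ne']
          exact (div_le_div_iff_of_pos_right (hb l l.2)).2 (by linarith)
        linarith
      rw [abs_le]
      have k1 := key A A' h2
      have k2 := key A' A fun l hl => by rw [abs_sub_comm]; exact h2 l hl
      constructor <;> linarith
  rw [loss, loss]
  refine (abs_max_sub_max_le_max _ _ _ _).trans ?_
  have hη : 0 ≤ η := (abs_nonneg _).trans harg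
  refine max_le (by simpa using hη) ((abs_min_sub_min_le_max _ _ _ _).trans (max_le (by simpa using hη) harg))

theorem loss_eq_one {A : ∀ l, net.Wt l} {γ : ℝ} {b : ℕ → ℝ} {p : net.Act 0 × Fin (net.U L)}
    {l : ℕ} (hl : l < L) (hb : 0 < b l) (h : 2 * b l ≤ net.patchNorm l (net.F A l p.1)) :
    net.loss A γ b p = 1 := by
  have h1 := le_ciSup (f := fun l : Fin L => net.patchNorm l (net.F A l p.1) / b l - 1)
    (Set.finite_range _).bddAbove ⟨l, hl⟩
  have h2 : 2 ≤ net.patchNorm l (net.F A l p.1) / b l := by rwa [le_div_iff₀ hb]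
  have h3 : 1 ≤ net.lossArg A γ b p := by
    rw [lossArg]
    refine le_max_of_le_right ?_
    simp only at h1
    linarith
  rw [loss, min_eq_left h3]
  simp

theorem abs_margin_sub_le (hK : 2 ≤ net.U L) {A A' : ∀ l, net.Wt l} {x x' : net.Act 0} (y : Fin (net.U L)) {c : ℝ}
    (h : ∀ j, |net.score A x j - net.score A' x' j| ≤ c) :
    |net.margin A x y - net.margin A' x' y| ≤ 2 * c := by
  have : Nontrivial (Fin (net.U L)) := Fin.nontrivial_iff_two_le.2 hK
  obtain ⟨j0, hj0⟩ := exists_ne y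
  have : Nonempty {j : Fin (net.U L) // j ≠ y} := ⟨⟨j0, hj0⟩⟩
  have key : ∀ (A A' : ∀ l, net.Wt l) (x x' : net.Act 0),
      (∀ j, |net.score A x j - net.score A' x' j| ≤ c) →
      (⨆ j : {j : Fin (net.U L) // j ≠ y}, net.score A x j) ≤
        (⨆ j : {j : Fin (net.U L) // j ≠ y}, net.score A' x' j) + c := by
    intro A A' x x' h
    refine ciSup_le fun j => ?_
    have h3 := le_ciSup (f := fun j : {j : Fin (net.U L) // j ≠ y} => net.score A' x' j)
      (Set.finite_range _).bddAbove j
    have := (abs_le.1 (h j)).2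
    linarith
  have k1 := key A A' x x' h
  have k2 := key A' A x' x fun j => by rw [abs_sub_comm]; exact h j
  have := abs_le.1 (h y)
  rw [margin, margin, abs_le]
  constructor <;> linarith

/-- Approximate weights have approximately the same loss. -/
theorem abs_loss_sub_le_of_approx (hfc : net.LastFullyConnected) (hK : 2 ≤ net.U L) (hL : 0 < L)
    {A A' : ∀ l, net.Wt l} {s ε b P : ℕ → ℝ} (p : net.Act 0 × Fin (net.U L))
    (hs : ∀ l, l < L → net.sigmaPrime l (A l) ≤ s l) (hb : ∀ l, l ≤ L → 0 < b l)
    (hε : ∀ l, l < L → 0 ≤ ε l)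
    (hP : ∀ i l, i < l → l ≤ L → net.ρ i * Real.sqrt (net.w (i + 1)) *
      (∏ j ∈ Finset.Ico (i + 1) l, (net.ρ j : ℝ) * s j) / b l ≤ P i)
    (hη : 2 * ∑ i ∈ Finset.range L, P i * ε i ≤ 1)
    (happ : ∀ i, i < L → net.patchNorm i (net.F A' i p.1) ≤ 3 * b i →
      net.Approx A A' i p.1 (ε i)) :
    |net.loss A (b L) b p - net.loss A' (b L) b p| ≤ 2 * ∑ i ∈ Finset.range L, P i * ε i := by
  set η := ∑ i ∈ Finset.range L, P i * ε i with hηdef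
  have hs0 : ∀ l, l < L → 0 ≤ s l := fun l hl => (net.sigmaPrime_nonneg l (A l)).trans (hs l hl)
  have hP0 : ∀ i, i < L → 0 ≤ P i := fun i hi => by
    refine le_trans ?_ (hP i (i + 1) (by omega) hi)
    have := hb (i + 1) hi
    simp only [Finset.Ico_self, Finset.prod_empty]
    positivity
  have herr : ∀ l, l ≤ L → net.accError s ε l ≤ η * b l := by
    intro l hl
    rw [← div_le_iff₀ (hb l hl), accError, Finset.sum_div]
    calc _ ≤ ∑ i ∈ Finset.range l, P i * ε i := by
          refine Finset.sum_le_sum fun i hi => ?_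
          have hi' := Finset.mem_range.1 hi
          rw [mul_div_right_comm]
          exact mul_le_mul_of_nonneg_right (hP i l hi' hl) (hε i (by omega))
      _ ≤ η := Finset.sum_le_sum_of_subset_of_nonneg (Finset.range_mono hl) fun i hi _ =>
          mul_nonneg (hP0 i (Finset.mem_range.1 hi)) (hε i (Finset.mem_range.1 hi))
  have hη0 : 0 ≤ η := Finset.sum_nonneg fun i hi =>
    mul_nonneg (hP0 i (Finset.mem_range.1 hi)) (hε i (Finset.mem_range.1 hi))
  by_cases hdead : ∃ l, l < L ∧ 3 * b l < net.patchNorm l (net.F A' l p.1)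
  · classical
    have hmin := fun i => Nat.find_min hdead (m := i)
    obtain ⟨hl, hbig⟩ := Nat.find_spec hdead
    set l := Nat.find hdead
    have hA := net.l2_F_sub_le (ε := ε) p.1 hs l hl fun i hi => happ i (by omega) (by
      have := hmin i hi
      push Not at this
      exact this (by omega))
    have h2 := (net.abs_patchNorm_sub_le hl _ _).trans (hA.trans (herr l hl.le))
    have hbl := hb l hl.le
    have h3 : η * b l ≤ b l := by nlinarith
    have h4 : 2 * b l ≤ net.patchNorm l (net.F A l p.1) := by linarith [(abs_le.1 h2).2]
    rw [net.loss_eq_one hl hbl h4, net.loss_eq_one hl hbl (by linarith)]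
    simpa using hη0
  · push Not at hdead
    have happ' : ∀ i, i < L → net.Approx A A' i p.1 (ε i) := fun i hi => happ i hi (hdead i hi)
    refine net.abs_loss_sub_le hL (hb L le_rfl) (fun l hl => hb l hl.le) ?_ fun l hl => ?_
    · have h := net.abs_margin_sub_le hK (A := A') (A' := A) (x := p.1) (x' := p.1) p.2 (c := η * b L)
        fun j => (net.abs_F_last_sub_le hfc hL p.1 hs happ' _).trans (herr L le_rfl)
      linarith
    · have := (net.abs_patchNorm_sub_le hl _ _).trans
        ((net.l2_F_sub_le (ε := ε) p.1 hs l hl fun i hi => happ' i (by omega)).trans (herr l hl.le))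
      have hbl := hb l hl.le
      refine this.trans ?_
      nlinarith [mul_nonneg hη0 hbl.le]

end ConvArch

/-! ### Deviation inequality for a class of weights -/

/-- The `ℓ^{2/3}` quasi-norm. -/
noncomputable def quasiNorm (L : ℕ) (t : ℕ → ℝ) : ℝ :=
  (∑ l ∈ Finset.range L, t l ^ ((2 : ℝ) / 3)) ^ ((3 : ℝ) / 2)

theorem quasiNorm_nonneg {L : ℕ} {t : ℕ → ℝ} (ht : ∀ l, l < L → 0 ≤ t l) : 0 ≤ quasiNorm L t :=
  Real.rpow_nonneg (Finset.sum_nonneg fun l hl => Real.rpow_nonneg (ht l (Finset.mem_range.1 hl)) _) _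

theorem quasiNorm_mono {L : ℕ} {t u : ℕ → ℝ} (ht : ∀ l, l < L → 0 ≤ t l)
    (h : ∀ l, l < L → t l ≤ u l) : quasiNorm L t ≤ quasiNorm L u := by
  refine Real.rpow_le_rpow (Finset.sum_nonneg fun l hl =>
    Real.rpow_nonneg (ht l (Finset.mem_range.1 hl)) _) ?_ (by norm_num)
  refine Finset.sum_le_sum fun l hl => ?_
  have hl' := Finset.mem_range.1 hl
  exact Real.rpow_le_rpow (ht l hl') (h l hl') (by norm_num)

theorem quasiNorm_const_mul {L : ℕ} {c : ℝ} (hc : 0 ≤ c) {t : ℕ → ℝ} (ht : ∀ l, l < L → 0 ≤ t l) :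
    quasiNorm L (fun l => c * t l) = c * quasiNorm L t := by
  have h1 : ∑ l ∈ Finset.range L, (c * t l) ^ ((2 : ℝ) / 3) =
      c ^ ((2 : ℝ) / 3) * ∑ l ∈ Finset.range L, t l ^ ((2 : ℝ) / 3) := by
    rw [Finset.mul_sum]
    exact Finset.sum_congr rfl fun l hl => Real.mul_rpow hc (ht l (Finset.mem_range.1 hl))
  rw [quasiNorm, h1, Real.mul_rpow (Real.rpow_nonneg hc _)
    (Finset.sum_nonneg fun l hl => Real.rpow_nonneg (ht l (Finset.mem_range.1 hl)) _),
    ← Real.rpow_mul hc]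
  norm_num
  exact Or.inl rfl

theorem le_quasiNorm {L : ℕ} {t : ℕ → ℝ} (ht : ∀ l, l < L → 0 ≤ t l) {l : ℕ} (hl : l < L) :
    t l ≤ quasiNorm L t := by
  have h1 : t l ^ ((2 : ℝ) / 3) ≤ ∑ i ∈ Finset.range L, t i ^ ((2 : ℝ) / 3) :=
    Finset.single_le_sum (f := fun i => t i ^ ((2 : ℝ) / 3))
      (fun i hi => Real.rpow_nonneg (ht i (Finset.mem_range.1 hi)) _) (Finset.mem_range.2 hl)
  have h2 : t l = (t l ^ ((2 : ℝ) / 3)) ^ ((3 : ℝ) / 2) := by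
    rw [← Real.rpow_mul (ht l hl)]; norm_num
  rw [h2]
  exact Real.rpow_le_rpow (Real.rpow_nonneg (ht l hl) _) h1 (by norm_num)

/-- The distribution of a total precision over the layers. -/
theorem exists_budget {L : ℕ} {t : ℕ → ℝ} (ht : ∀ l, l < L → 0 ≤ t l) {ε : ℝ} (hε : 0 < ε) :
    ∃ k : ℕ → ℕ, (∑ l ∈ Finset.range L, (k l : ℝ)) ≤ 16 * quasiNorm L t ^ 2 / ε ^ 2 ∧
      ∑ l ∈ Finset.range L, t l * ConvArch.precision (k l) ≤ ε / 2 := by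
  set u : ℕ → ℝ := fun l => t l ^ ((1 : ℝ) / 3) with hu
  have hu0 : ∀ l, l < L → 0 ≤ u l := fun l hl => Real.rpow_nonneg (ht l hl) _
  have hu3 : ∀ l, l < L → t l = u l ^ 3 := fun l hl => by
    rw [hu]
    simp only
    rw [← Real.rpow_natCast, ← Real.rpow_mul (ht l hl)]
    norm_num
  have hu2 : ∀ l, l < L → t l ^ ((2 : ℝ) / 3) = u l ^ 2 := fun l hl => by
    rw [hu]
    simp only
    rw [← Real.rpow_natCast, ← Real.rpow_mul (ht l hl)]
    norm_num
  set S := ∑ l ∈ Finset.range L, u l ^ 2 with hS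
  have hS0 : 0 ≤ S := Finset.sum_nonneg fun _ _ => sq_nonneg _
  have hR : quasiNorm L t ^ 2 = S ^ 3 := by
    have : quasiNorm L t = S ^ ((3 : ℝ) / 2) := by
      rw [quasiNorm]
      congr 1
      exact Finset.sum_congr rfl fun l hl => hu2 l (Finset.mem_range.1 hl)
    rw [this, ← Real.rpow_natCast, ← Real.rpow_mul hS0, ← Real.rpow_natCast]
    norm_num
  set x : ℕ → ℝ := fun l => 8 * u l ^ 2 * S ^ 2 / ε ^ 2 with hx
  have hx0 : ∀ l, 0 ≤ x l := fun l => by positivity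
  refine ⟨fun l => if 1 ≤ x l then ⌈x l⌉₊ else 0, ?_, ?_⟩
  · have h1 : ∀ l, ((if 1 ≤ x l then ⌈x l⌉₊ else 0 : ℕ) : ℝ) ≤ 2 * x l := by
      intro l
      split_ifs with h
      · have := Nat.ceil_lt_add_one (hx0 l)
        linarith
      · simpa using hx0 l
    refine (Finset.sum_le_sum fun l _ => h1 l).trans (le_of_eq ?_)
    rw [hR]
    calc ∑ l ∈ Finset.range L, 2 * x l = ∑ l ∈ Finset.range L, u l ^ 2 * (16 * S ^ 2 / ε ^ 2) :=
          Finset.sum_congr rfl fun l _ => by simp only [hx]; ring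
      _ = _ := by rw [← Finset.sum_mul, ← hS]; ring
  · have h1 : ∀ l, l < L →
        t l * ConvArch.precision (if 1 ≤ x l then ⌈x l⌉₊ else 0) * S ≤ ε / 2 * u l ^ 2 := by
      intro l hl
      have hul := hu0 l hl
      rw [hu3 l hl]
      split_ifs with h
      · have hxpos : 0 < x l := by linarith
        have hne : u l ≠ 0 ∧ S ≠ 0 := by
          constructor <;> rintro h0 <;> simp [hx, h0] at hxpos
        have hupos := lt_of_le_of_ne hul hne.1.symm
        have hSpos := lt_of_le_of_ne hS0 hne.2.symm
        have hk : ⌈x l⌉₊ ≠ 0 := (Nat.ceil_pos.2 hxpos).ne'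
        rw [ConvArch.precision, if_neg hk]
        have h2 : Real.sqrt (2 / (⌈x l⌉₊ : ℝ)) ≤ ε / (2 * u l * S) := by
          refine Real.sqrt_le_iff.2 ⟨by positivity, ?_⟩
          have : (ε / (2 * u l * S)) ^ 2 = 2 / x l := by
            simp only [hx]; field_simp; norm_num
          rw [this]
          gcongr
          exact Nat.le_ceil _
        calc u l ^ 3 * Real.sqrt (2 / (⌈x l⌉₊ : ℝ)) * S ≤ u l ^ 3 * (ε / (2 * u l * S)) * S := by gcongr
          _ = _ := by field_simp
      · rw [ConvArch.precision, if_pos rfl, mul_one]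
        push Not at h
        have h3 : (u l * S) * 2 ≤ ε := by
          simp only [hx] at h
          rw [div_lt_one (by positivity)] at h
          refine le_of_sq_le_sq ?_ hε.le
          nlinarith [sq_nonneg (u l * S)]
        nlinarith [sq_nonneg (u l)]
    rcases hS0.eq_or_lt with h0 | h0
    · have : ∀ l ∈ Finset.range L, t l * ConvArch.precision (if 1 ≤ x l then ⌈x l⌉₊ else 0) = 0 := by
        intro l hl
        have := (Finset.sum_eq_zero_iff_of_nonneg fun _ _ => sq_nonneg _).1 h0.symm l hl
        rw [hu3 l (Finset.mem_range.1 hl), pow_eq_zero_iff two_ne_zero |>.1 this]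
        simp
      rw [Finset.sum_eq_zero this]
      positivity
    · refine le_of_mul_le_mul_right ?_ h0
      rw [Finset.sum_mul, hS, Finset.mul_sum, ← hS]
      exact Finset.sum_le_sum fun l hl => h1 l (Finset.mem_range.1 hl)

namespace ConvArch

variable {L : ℕ} (net : ConvArch L)

/-- The sensitivity of the loss to a perturbation at layer `i`, for spectral bounds `s` and activation
bounds `b`. -/
noncomputable def sensitivity (s b : ℕ → ℝ) (i : ℕ) : ℝ :=
  net.ρ i * Real.sqrt (net.w (i + 1)) *
    ⨆ l : Finset.Icc (i + 1) L, (∏ j ∈ Finset.Ico (i + 1) (l : ℕ), (net.ρ j : ℝ) * s j) / b l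

theorem le_sensitivity (s b : ℕ → ℝ) {i l : ℕ} (hil : i < l) (hl : l ≤ L) :
    net.ρ i * Real.sqrt (net.w (i + 1)) *
      (∏ j ∈ Finset.Ico (i + 1) l, (net.ρ j : ℝ) * s j) / b l ≤ net.sensitivity s b i := by
  rw [sensitivity, mul_div_assoc]
  gcongr
  exact le_ciSup (f := fun l : Finset.Icc (i + 1) L =>
    (∏ j ∈ Finset.Ico (i + 1) (l : ℕ), (net.ρ j : ℝ) * s j) / b l) (Set.finite_range _).bddAbove
    ⟨l, Finset.mem_Icc.2 ⟨hil, hl⟩⟩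

theorem sensitivity_nonneg {s b : ℕ → ℝ} (hs : ∀ l, l < L → 0 ≤ s l) (hb : ∀ l, l ≤ L → 0 ≤ b l)
    (i : ℕ) : 0 ≤ net.sensitivity s b i := by
  refine mul_nonneg (by positivity) (Real.iSup_nonneg fun l => ?_)
  have hl := Finset.mem_Icc.1 l.2
  refine div_nonneg (Finset.prod_nonneg fun j hj => ?_) (hb _ hl.2)
  have := hs j (by have := (Finset.mem_Ico.1 hj).2; omega)
  positivity

/-- The weights close to `M` with spectral bounds `s`. -/
def weightClass (M : ∀ l, net.Wt l) (a s : ℕ → ℝ) : Set (∀ l, net.Wt l) :=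
  {A | ∀ l, l < L → net.dist21 l (A l) (M l) ≤ a l ∧ net.sigmaPrime l (A l) ≤ s l}

theorem exists_loss_net (hfc : net.LastFullyConnected) (hK : 2 ≤ net.U L) (hL : 0 < L)
    {T : Type*} [Fintype T] [Nonempty T] (x : T → net.Act 0 × Fin (net.U L)) (M : ∀ l, net.Wt l)
    {a s b : ℕ → ℝ} (ha : ∀ l, l < L → 0 < a l) (hs : ∀ l, l < L → 0 ≤ s l)
    (hb : ∀ l, l ≤ L → 0 < b l) {W : ℝ} (hW : ∀ l, l < L → (net.O l : ℝ) * net.m (l + 1) ≤ W)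
    {ε : ℝ} (hε : 0 < ε) (hε1 : ε ≤ 1) :
    ∃ N : Finset (∀ l, net.Wt l),
      (N.card : ℝ) ≤ Real.exp (16 * quasiNorm L (fun l => a l * (3 * b l) * net.sensitivity s b l) ^ 2 /
        ε ^ 2 * Real.log (3 * Fintype.card T * W + 1)) ∧
      ∀ A ∈ net.weightClass M a s, ∃ A' ∈ N, ∀ t,
        |net.loss A (b L) b (x t) - net.loss A' (b L) b (x t)| ≤ ε := by
  have hsens := net.sensitivity_nonneg hs fun l hl => (hb l hl).le
  have hW0 : 0 ≤ W := le_trans (by positivity) (hW 0 hL)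
  obtain ⟨k, hk, hsum⟩ := exists_budget (L := L)
    (t := fun l => a l * (3 * b l) * net.sensitivity s b l)
    (fun l hl => mul_nonneg (mul_nonneg (ha l hl).le (by have := hb l hl.le; positivity)) (hsens l)) hε
  obtain ⟨N, hcard, hN⟩ := net.exists_net (fun t => (x t).1) M (a := a) (b := fun l => 3 * b l) ha
    (fun l hl => by have := hb l hl.le; positivity) k L le_rfl
  refine ⟨N, ?_, fun A hA => ?_⟩
  · have hbase : ∀ i ∈ Finset.range L,
        ((3 * net.m (i + 1) * (Fintype.card T * net.O i) + 1 : ℕ) : ℝ) ^ k i ≤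
          (3 * Fintype.card T * W + 1) ^ k i := by
      intro i hi
      refine pow_le_pow_left₀ (by positivity) ?_ _
      push_cast
      have := mul_le_mul_of_nonneg_left (hW i (Finset.mem_range.1 hi))
        (show (0 : ℝ) ≤ 3 * Fintype.card T by positivity)
      nlinarith
    have hpos : (0 : ℝ) < 3 * Fintype.card T * W + 1 := by positivity
    calc (N.card : ℝ) ≤ ∏ i ∈ Finset.range L,
          ((3 * net.m (i + 1) * (Fintype.card T * net.O i) + 1 : ℕ) : ℝ) ^ k i := by
            exact_mod_cast hcard
      _ ≤ ∏ i ∈ Finset.range L, (3 * Fintype.card T * W + 1) ^ k i :=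
          Finset.prod_le_prod (fun i _ => by positivity) hbase
      _ = Real.exp ((∑ i ∈ Finset.range L, (k i : ℝ)) * Real.log (3 * Fintype.card T * W + 1)) := by
          rw [Finset.prod_pow_eq_pow_sum, ← Real.rpow_natCast, Real.rpow_def_of_pos hpos, mul_comm]
          push_cast
          rfl
      _ ≤ _ := by
          rw [Real.exp_le_exp]
          refine mul_le_mul_of_nonneg_right hk (Real.log_nonneg ?_)
          have : (0 : ℝ) ≤ 3 * Fintype.card T * W := by positivity
          linarith
  · obtain ⟨A', hA', happ⟩ := hN A fun i hi => (hA i hi).1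
    refine ⟨A', hA', fun t => ?_⟩
    have hle : 2 * ∑ i ∈ Finset.range L,
        net.sensitivity s b i * (a i * (3 * b i) * precision (k i)) ≤ ε := by
      have : ∑ i ∈ Finset.range L, net.sensitivity s b i * (a i * (3 * b i) * precision (k i)) =
          ∑ i ∈ Finset.range L, a i * (3 * b i) * net.sensitivity s b i * precision (k i) :=
        Finset.sum_congr rfl fun i _ => by ring
      rw [this]
      linarith
    refine (net.abs_loss_sub_le_of_approx hfc hK hL (x t) (fun l hl => (hA l hl).2) hb ?_
      (fun i l hil hl => net.le_sensitivity s b hil hl) (hle.trans hε1)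
      fun i hi h => happ i hi t h).trans hle
    intro l hl
    have := hb l hl.le
    have := ha l hl
    have := precision_nonneg (k l)
    positivity

theorem measure_class_deviation_le (hfc : net.LastFullyConnected) (hK : 2 ≤ net.U L) (hL : 0 < L)
    {n : ℕ} (hn : 0 < n) (μ : Measure (net.Act 0 × Fin (net.U L))) [IsProbabilityMeasure μ]
    (M : ∀ l, net.Wt l) {a s b : ℕ → ℝ} (ha : ∀ l, l < L → 0 < a l) (hs : ∀ l, l < L → 0 ≤ s l)
    (hb : ∀ l, l ≤ L → 0 < b l) {W : ℝ} (hW : ∀ l, l < L → (net.O l : ℝ) * net.m (l + 1) ≤ W)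
    (hW1 : 1 ≤ W) {t : ℝ} (ht : 0 ≤ t) :
    (Measure.pi fun _ : Fin n => μ) {S | ∃ A ∈ net.weightClass M a s,
      8 / n + 55 / Real.sqrt n *
        quasiNorm L (fun l => a l * (3 * b l) * net.sensitivity s b l) *
          Real.sqrt (Real.log (7 * W * n)) * Real.log n + t <
        (∫ p, net.loss A (b L) b p ∂μ) - (∑ j, net.loss A (b L) b (S j)) / n} ≤
      ENNReal.ofReal (Real.exp (-(n * t ^ 2 / 2))) := by
  classical
  have hn' : (0 : ℝ) < n := by exact_mod_cast hn
  have hn1 : (1 : ℝ) ≤ n := by exact_mod_cast hn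
  set R := quasiNorm L (fun l => a l * (3 * b l) * net.sensitivity s b l) with hR
  have hR0 : 0 ≤ R := quasiNorm_nonneg fun l hl => mul_nonneg
    (mul_nonneg (ha l hl).le (by have := hb l hl.le; positivity))
    (net.sensitivity_nonneg hs (fun l hl => (hb l hl).le) l)
  have hlog : 0 ≤ Real.log (7 * W * n) := Real.log_nonneg (by nlinarith)
  set Q := 16 * R ^ 2 * Real.log (7 * W * n) with hQ
  have hQ0 : 0 ≤ Q := by positivity
  set D := 8 / n + 55 / Real.sqrt n * R * Real.sqrt (Real.log (7 * W * n)) * Real.log n with hD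
  rcases (net.weightClass M a s).eq_empty_or_nonempty with he | ⟨A₀, hA₀⟩
  · simp [he]
  have hne : Nonempty (net.weightClass M a s) := ⟨⟨A₀, hA₀⟩⟩
  have hNn : Nonempty (Fin n) := ⟨⟨0, hn⟩⟩
  have key := measure_exists_deviation_le μ hn
    (fun (A : net.weightClass M a s) p => net.loss A.1 (b L) b p)
    (fun A => net.continuous_loss _ _ _) (fun A => net.loss_nonneg _ _ _)
    (fun A => net.loss_le_one _ _ _) D t ht ?_
  · refine le_trans (measure_mono ?_) key
    rintro S ⟨A, hA, h⟩
    exact ⟨⟨A, hA⟩, h⟩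
  intro z
  have hv1 : ∀ (A : net.weightClass M a s) j,
      |net.loss A.1 (b L) b (z j).1 - net.loss A.1 (b L) b (z j).2| ≤ 1 := by
    intro A j
    rw [abs_le]
    constructor <;> linarith [net.loss_nonneg A.1 (b L) b (z j).1, net.loss_nonneg A.1 (b L) b (z j).2,
      net.loss_le_one A.1 (b L) b (z j).1, net.loss_le_one A.1 (b L) b (z j).2]
  have hch := Rademacher.mean_iSup_rsum_le hn
    (fun (A : net.weightClass M a s) j => net.loss A.1 (b L) b (z j).1 - net.loss A.1 (b L) b (z j).2)
    hv1 hQ0 (Nat.log 2 n) ?_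
  · refine hch.trans ?_
    have h1 : (n : ℝ) * (2 / 2 ^ Nat.log 2 n) ≤ 8 := by
      have h2 : (n : ℝ) < 2 ^ (Nat.log 2 n + 1) := by
        exact_mod_cast Nat.lt_pow_succ_log_self (by norm_num) n
      rw [pow_succ] at h2
      rw [mul_div_assoc', div_le_iff₀ (by positivity)]
      have : (0 : ℝ) < 2 ^ Nat.log 2 n := by positivity
      linarith
    have h3 : (Nat.log 2 n : ℝ) ≤ Real.log n / Real.log 2 := by
      rw [le_div_iff₀ (Real.log_pos one_lt_two), ← Real.log_pow]
      refine Real.log_le_log (by positivity) ?_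
      exact_mod_cast Nat.pow_log_le_self 2 hn.ne'
    have h4 : Real.sqrt (5 / 2 * n * Q) =
        Real.sqrt n * R * Real.sqrt (Real.log (7 * W * n)) * Real.sqrt 40 := by
      have : 5 / 2 * n * Q = n * R ^ 2 * Real.log (7 * W * n) * 40 := by rw [hQ]; ring
      rw [this, Real.sqrt_mul (by positivity), Real.sqrt_mul (by positivity),
        Real.sqrt_mul hn'.le, Real.sqrt_sq hR0]
    have h5 : Real.sqrt 40 ≤ 6.33 := by
      rw [Real.sqrt_le_iff]; norm_num
    have hlogn : 0 ≤ Real.log n := Real.log_nonneg hn1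
    have h6 : Real.log n / Real.log 2 ≤ 1.4428 * Real.log n := by
      rw [div_le_iff₀ (Real.log_pos one_lt_two)]
      have := Real.log_two_gt_d9
      nlinarith
    set X := Real.sqrt n * R * Real.sqrt (Real.log (7 * W * n)) with hX
    have hX0 : 0 ≤ X := by positivity
    have h7 : (Nat.log 2 n : ℝ) * (6 * Real.sqrt (5 / 2 * n * Q)) ≤ 55 * X * Real.log n := by
      rw [h4]
      calc (Nat.log 2 n : ℝ) * (6 * (X * Real.sqrt 40)) ≤ (1.4428 * Real.log n) * (6 * (X * 6.33)) := by
            gcongr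
            exact h3.trans h6
        _ = (1.4428 * 6 * 6.33) * (X * Real.log n) := by ring
        _ ≤ 55 * (X * Real.log n) := by gcongr; norm_num
        _ = _ := by ring
    have h8 : (n : ℝ) * D = 8 + 55 * X * Real.log n := by
      have hsq : (n : ℝ) / Real.sqrt n = Real.sqrt n := Real.div_sqrt
      calc (n : ℝ) * D = 8 * (n / n) + 55 * ((n / Real.sqrt n) * R *
            Real.sqrt (Real.log (7 * W * n))) * Real.log n := by rw [hD]; ring
        _ = _ := by rw [hsq, div_self hn'.ne', mul_one]
    rw [h8]
    exact add_le_add h1 h7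
  · intro k
    obtain ⟨N, hcard, hN⟩ := net.exists_loss_net hfc hK hL (T := Fin n × Bool)
      (fun t => if t.2 then (z t.1).1 else (z t.1).2) M ha hs hb hW (ε := 1 / 2 ^ (k + 1))
      (by positivity) (by
        rw [div_le_one (by positivity)]
        exact one_le_pow₀ one_le_two)
    refine ⟨N.image fun A' j => net.loss A' (b L) b (z j).1 - net.loss A' (b L) b (z j).2, ?_, fun A => ?_⟩
    · refine le_trans (by exact_mod_cast Finset.card_image_le) (hcard.trans ?_)
      rw [Real.exp_le_exp, ← hR]
      have h1 : (16 : ℝ) * R ^ 2 / (1 / 2 ^ (k + 1)) ^ 2 = 16 * R ^ 2 * 4 ^ (k + 1) := by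
        rw [div_pow, one_pow, ← pow_mul, mul_comm (k + 1) 2, pow_mul]
        norm_num
      rw [h1, hQ, mul_right_comm]
      refine mul_le_mul_of_nonneg_right ?_ (by positivity)
      refine mul_le_mul_of_nonneg_left ?_ (by positivity)
      simp only [Fintype.card_prod, Fintype.card_fin, Fintype.card_bool]
      push_cast
      refine Real.log_le_log (by positivity) ?_
      nlinarith
    · obtain ⟨A', hA', h⟩ := hN A.1 A.2
      refine ⟨_, Finset.mem_image_of_mem _ hA', fun j => ?_⟩
      have h1 := h (j, true)
      have h2 := h (j, false)
      simp only [if_true, Bool.false_eq_true, if_false] at h1 h2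
      have e : (2 : ℝ) / 2 ^ (k + 1) = 1 / 2 ^ (k + 1) + 1 / 2 ^ (k + 1) := by rw [← add_div]; norm_num
      rw [e]
      rw [abs_le] at h1 h2 ⊢
      constructor <;> linarith [h1.1, h1.2, h2.1, h2.2]

end ConvArch

/-! ### The union bound -/

theorem ENNReal.tsum_pi_prod_le_one {α : Type*} {v : α → ENNReal} (hv : ∑' x, v x ≤ 1) :
    ∀ n : ℕ, ∑' f : Fin n → α, ∏ i, v (f i) ≤ 1 := by
  intro n
  induction n with
  | zero => simp
  | succ n ih =>
    rw [← (Fin.consEquiv fun _ : Fin (n + 1) => α).tsum_eq, ENNReal.tsum_prod']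
    calc ∑' (x : α) (f : Fin n → α), ∏ i, v ((Fin.consEquiv fun _ : Fin (n + 1) => α) (x, f) i)
        = ∑' (x : α) (f : Fin n → α), v x * ∏ i, v (f i) := by
          refine tsum_congr fun x => tsum_congr fun f => ?_
          rw [Fin.prod_univ_succ]
          rfl
      _ = (∑' x, v x) * ∑' f : Fin n → α, ∏ i, v (f i) := by
          simp_rw [ENNReal.tsum_mul_left, ENNReal.tsum_mul_right]
      _ ≤ 1 := mul_le_one' hv ih

/-- Summable weights on the natural numbers. -/
noncomputable def natWeight (k : ℕ) : ℝ := 1 / ((k + 1) * (k + 2))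

theorem natWeight_pos (k : ℕ) : 0 < natWeight k := by unfold natWeight; positivity

theorem tsum_natWeight_le_one : ∑' k, ENNReal.ofReal (natWeight k) ≤ 1 := by
  refine ENNReal.tsum_le_of_sum_range_le fun N => ?_
  rw [← ENNReal.ofReal_sum_of_nonneg fun k _ => (natWeight_pos k).le, ← ENNReal.ofReal_one]
  refine ENNReal.ofReal_le_ofReal ?_
  have : ∀ N : ℕ, ∑ k ∈ Finset.range N, natWeight k = 1 - 1 / (N + 1) := by
    intro N
    induction N with
    | zero => simp
    | succ N ih =>
      rw [Finset.sum_range_succ, ih, natWeight]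
      push_cast
      field_simp
      ring
  rw [this]
  have : (0 : ℝ) ≤ 1 / ((N : ℝ) + 1) := by positivity
  linarith

/-- The weight of a family of grid indices. -/
noncomputable def familyWeight {L : ℕ} (k : Fin L → ℕ) : ℝ := ∏ l, natWeight (k l)

theorem familyWeight_pos {L : ℕ} (k : Fin L → ℕ) : 0 < familyWeight k :=
  Finset.prod_pos fun _ _ => natWeight_pos _

theorem tsum_familyWeight_le_one (L : ℕ) :
    ∑' k : Fin L → ℕ, ENNReal.ofReal (familyWeight k) ≤ 1 := by
  have := ENNReal.tsum_pi_prod_le_one tsum_natWeight_le_one L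
  refine le_of_eq_of_le (tsum_congr fun k => ?_) this
  rw [familyWeight, ENNReal.ofReal_prod_of_nonneg fun l _ => (natWeight_pos _).le]

/-- The weight of a margin scale. -/
noncomputable def scaleWeight (q : ℕ × Fin 3) : ℝ := (1 / 2) ^ (q.1 + 1) / 3

theorem scaleWeight_pos (q : ℕ × Fin 3) : 0 < scaleWeight q := by unfold scaleWeight; positivity

theorem tsum_scaleWeight_le_one : ∑' q, ENNReal.ofReal (scaleWeight q) ≤ 1 := by
  rw [ENNReal.tsum_prod']
  have h1 : ∀ q : ℕ, ∑' c : Fin 3, ENNReal.ofReal (scaleWeight (q, c)) =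
      ENNReal.ofReal ((1 / 2) ^ (q + 1)) := by
    intro q
    rw [tsum_fintype, ← ENNReal.ofReal_sum_of_nonneg fun c _ => (scaleWeight_pos _).le]
    congr 1
    simp [scaleWeight]
    ring
  simp_rw [h1]
  refine ENNReal.tsum_le_of_sum_range_le fun N => ?_
  rw [← ENNReal.ofReal_sum_of_nonneg fun k _ => by positivity, ← ENNReal.ofReal_one]
  refine ENNReal.ofReal_le_ofReal ?_
  have : ∀ N : ℕ, ∑ k ∈ Finset.range N, ((1 : ℝ) / 2) ^ (k + 1) = 1 - (1 / 2) ^ N := by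
    intro N
    induction N with
    | zero => simp
    | succ N ih => rw [Finset.sum_range_succ, ih]; ring
  rw [this]
  have : (0 : ℝ) ≤ (1 / 2) ^ N := by positivity
  linarith

/-- The indices of the cells of the space of parameters: grid indices for the distances to the
reference matrices, the spectral norms and the activation bounds, and a margin scale. -/
abbrev CellIndex (L : ℕ) := (Fin L → ℕ) × (Fin L → ℕ) × (Fin L → ℕ) × (ℕ × Fin 3)

/-- The weight of a cell in the union bound. -/
noncomputable def cellWeight {L : ℕ} (θ : CellIndex L) : ℝ :=
  familyWeight θ.1 * (familyWeight θ.2.1 * (familyWeight θ.2.2.1 * scaleWeight θ.2.2.2))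

theorem cellWeight_pos {L : ℕ} (θ : CellIndex L) : 0 < cellWeight θ := by
  have h1 := familyWeight_pos θ.1
  have h2 := familyWeight_pos θ.2.1
  have h3 := familyWeight_pos θ.2.2.1
  have h4 := scaleWeight_pos θ.2.2.2
  unfold cellWeight
  positivity

theorem ENNReal.tsum_prod_mul_le_one {α β : Type*} {v : α → ℝ} {w : β → ℝ}
    (hv0 : ∀ x, 0 ≤ v x) (hv : ∑' x, ENNReal.ofReal (v x) ≤ 1)
    (hw : ∑' y, ENNReal.ofReal (w y) ≤ 1) :
    ∑' p : α × β, ENNReal.ofReal (v p.1 * w p.2) ≤ 1 := by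
  rw [ENNReal.tsum_prod']
  simp_rw [ENNReal.ofReal_mul (hv0 _), ENNReal.tsum_mul_left, ENNReal.tsum_mul_right]
  exact mul_le_one' hv hw

theorem tsum_cellWeight_le_one (L : ℕ) :
    ∑' θ : CellIndex L, ENNReal.ofReal (cellWeight θ) ≤ 1 := by
  have h := tsum_familyWeight_le_one L
  have h0 : ∀ k : Fin L → ℕ, 0 ≤ familyWeight k := fun k => (familyWeight_pos k).le
  exact ENNReal.tsum_prod_mul_le_one h0 h (ENNReal.tsum_prod_mul_le_one h0 h
    (ENNReal.tsum_prod_mul_le_one h0 h tsum_scaleWeight_le_one))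

/-- The values on the grid of mesh `1 / L`, followed by the constant `c`. -/
noncomputable def gridValue {L : ℕ} (k : Fin L → ℕ) (c : ℝ) (l : ℕ) : ℝ :=
  if h : l < L then ((k ⟨l, h⟩ : ℝ) + 1) / L else c

/-- The grid index of a value. -/
noncomputable def gridIndex (L : ℕ) (v : ℕ → ℝ) (l : Fin L) : ℕ := ⌊L * v l⌋₊

theorem gridValue_pos {L : ℕ} (k : Fin L → ℕ) (c : ℝ) {l : ℕ} (hl : l < L) :
    0 < gridValue k c l := by
  have : (0 : ℝ) < L := by exact_mod_cast (by omega : 0 < L)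
  rw [gridValue, dif_pos hl]
  positivity

theorem le_gridValue {L : ℕ} {v : ℕ → ℝ} (c : ℝ) {l : ℕ} (hl : l < L) :
    v l ≤ gridValue (gridIndex L v) c l := by
  have : (0 : ℝ) < L := by exact_mod_cast (by omega : 0 < L)
  rw [gridValue, dif_pos hl, le_div_iff₀ this, gridIndex, mul_comm]
  exact (Nat.lt_floor_add_one _).le

theorem gridValue_le {L : ℕ} {v : ℕ → ℝ} (c : ℝ) {l : ℕ} (hl : l < L) (hv : 0 ≤ v l) :
    gridValue (gridIndex L v) c l ≤ v l + 1 / L := by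
  have : (0 : ℝ) < L := by exact_mod_cast (by omega : 0 < L)
  rw [gridValue, dif_pos hl, div_le_iff₀ this, add_mul, div_mul_cancel₀ _ this.ne', gridIndex,
    mul_comm (v l)]
  have := Nat.floor_le (a := (L : ℝ) * v l) (by positivity)
  linarith

theorem log_inv_familyWeight_le {L : ℕ} {v : ℕ → ℝ} (hv : ∀ l, l < L → 0 ≤ v l) :
    -Real.log (familyWeight (gridIndex L v)) ≤
      2 * ∑ l ∈ Finset.range L, Real.log (2 + L * v l) := by
  rw [familyWeight, Real.log_prod fun l _ => (natWeight_pos _).ne', ← Finset.sum_neg_distrib,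
    Finset.mul_sum, Finset.sum_range]
  refine Finset.sum_le_sum fun l _ => ?_
  have h0 : (0 : ℝ) ≤ L * v l := mul_nonneg (by positivity) (hv l l.2)
  have h1 := Nat.floor_le h0
  rw [natWeight, one_div, Real.log_inv, neg_neg, gridIndex]
  rw [Real.log_mul (by positivity) (by positivity)]
  have h2 : Real.log ((⌊(L : ℝ) * v l⌋₊ : ℝ) + 1) ≤ Real.log (2 + L * v l) :=
    Real.log_le_log (by positivity) (by linarith)
  have h3 : Real.log ((⌊(L : ℝ) * v l⌋₊ : ℝ) + 2) ≤ Real.log (2 + L * v l) :=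
    Real.log_le_log (by positivity) (by linarith)
  linarith

namespace ConvArch

variable {L : ℕ} (net : ConvArch L)

/-- The largest margin of the constant network with zero weights. -/
noncomputable def constMargin : ℝ := ⨆ y, net.margin (fun _ => 0) 0 y

/-- The margin scales of the union bound. -/
noncomputable def marginScale (q : ℕ × Fin 3) : ℝ :=
  match q.2 with
  | 0 => net.ρ (L - 1) * 4 ^ q.1
  | 1 => net.ρ (L - 1) / 4 ^ q.1
  | 2 => net.constMargin / 2

theorem margin_zero_eq_constMargin (y : Fin (net.U L))
    (h : 0 < net.margin (fun _ => 0) 0 y) : net.margin (fun _ => 0) 0 y = net.constMargin := by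
  have : Nonempty (Fin (net.U L)) := ⟨y⟩
  refine le_antisymm (le_ciSup (f := fun y => net.margin (fun _ => 0) 0 y)
    (Set.finite_range _).bddAbove y) (ciSup_le fun y' => ?_)
  by_cases hy : y' = y
  · rw [hy]
  · have h1 := le_ciSup (f := fun j : {j : Fin (net.U L) // j ≠ y} => net.score (fun _ => 0) 0 j)
      (Set.finite_range _).bddAbove ⟨y', hy⟩
    have h2 := le_ciSup (f := fun j : {j : Fin (net.U L) // j ≠ y'} => net.score (fun _ => 0) 0 j)
      (Set.finite_range _).bddAbove ⟨y, fun h => hy h.symm⟩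
    rw [margin] at h ⊢
    rw [margin]
    simp only at h1 h2
    linarith

theorem l2_le_patchNorm (hfc : net.LastFullyConnected) {l : ℕ} (hl : l + 1 = L) (x : net.Act l) :
    l2 x ≤ net.patchNorm l x := by
  classical
  obtain ⟨hO, hsurj⟩ := hfc.2 l hl
  have o : Fin (net.O l) := ⟨0, by omega⟩
  refine le_trans ?_ (net.l2_patch_le_patchNorm l x o)
  obtain ⟨φ, hφ⟩ := (hsurj o).hasRightInverse
  have h := l2_comp_le (fun i => x (net.patch l o i)) hφ.injective
  simpa only [hφ _] using h

theorem abs_margin_sub_margin_zero_le (hfc : net.LastFullyConnected) (hK : 2 ≤ net.U L) {l : ℕ}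
    (hl : l + 1 = L) (A : ∀ l, net.Wt l) (x : net.Act 0) (y : Fin (net.U L)) {b : ℝ}
    (hb : net.patchNorm l (net.F A l x) ≤ b) :
    |net.margin A x y - net.margin (fun _ => 0) 0 y| ≤ 2 * (net.ρ l * net.sigmaPrime l (A l) * b) := by
  subst hl
  refine net.abs_margin_sub_le hK y fun j => ?_
  have h := net.abs_G_conv_last_sub_le rfl (A l) (net.F A l x) 0 (j, ⟨0, net.w_pos _ le_rfl⟩)
  have e : net.conv l (A l) 0 = net.conv l 0 (net.F (fun _ => 0) l 0) := by
    funext q; simp [conv]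
  rw [e, sub_zero] at h
  have hσ := net.sigmaPrime_nonneg l (A l)
  refine le_trans h ?_
  gcongr
  exact (net.l2_le_patchNorm hfc rfl _).trans hb

end ConvArch

namespace ConvArch

variable {L : ℕ} (net : ConvArch L)

/-- A margin can be replaced by one of the margin scales of the union bound. -/
theorem exists_marginScale (hfc : net.LastFullyConnected) (hK : 2 ≤ net.U L) {l : ℕ}
    (hl : l + 1 = L) {n : ℕ} (S : Fin n → net.Act 0 × Fin (net.U L)) (A : ∀ l, net.Wt l) {γ : ℝ}
    (hγ : 0 < γ) {B : ℕ → ℝ} (hB : ∀ l, l < L → 1 ≤ B l) {R : ℝ} (hR0 : 0 ≤ R)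
    (hR : net.ρ l / γ ≤ L * R) (hne : (net.goodSet A γ B S).Nonempty) :
    ∃ q : ℕ × Fin 3, 0 < net.marginScale q ∧ γ ≤ 4 * net.marginScale q ∧
      (∀ i ∈ net.goodSet A γ B S, net.marginScale q ≤ net.margin A (S i).1 (S i).2) ∧
      (4 : ℝ) ^ q.1 ≤ 6 * (2 + L * B l) * (2 + L * net.sigmaPrime l (A l)) * (1 + R) := by
  have hσ := net.sigmaPrime_nonneg l (A l)
  have hBl := hB l (by omega)
  have hL1 : (1 : ℝ) ≤ L := by exact_mod_cast (by omega : 1 ≤ L)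
  have hLl : L - 1 = l := by omega
  have hXL : (L : ℝ) ≤ L * B l := by nlinarith
  have hXB : B l ≤ L * B l := by nlinarith
  have hYσ : net.sigmaPrime l (A l) ≤ L * net.sigmaPrime l (A l) := by nlinarith
  set X := 2 + L * B l with hX
  set Y := 2 + L * net.sigmaPrime l (A l) with hY
  have hY2 : 2 ≤ Y := by rw [hY]; nlinarith
  have hX3 : 3 ≤ X := by linarith
  have hXY : 6 ≤ X * Y := by nlinarith
  by_cases hbig : 6 * (net.ρ l * net.sigmaPrime l (A l) * B l) ≤ γ
  · set e := net.ρ l * net.sigmaPrime l (A l) * B l with he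
    have hgood : ∀ i ∈ net.goodSet A γ B S,
        net.constMargin - 2 * e ≤ net.margin A (S i).1 (S i).2 ∧ γ - 2 * e < net.constMargin := by
      intro i hi
      have h1 := abs_le.1 (net.abs_margin_sub_margin_zero_le hfc hK hl A (S i).1 (S i).2
        (hi.2 l (by omega)))
      have h2 := hi.1
      have h3 := net.margin_zero_eq_constMargin (S i).2 (by linarith [h1.2])
      rw [h3] at h1
      constructor <;> linarith [h1.1, h1.2]
    obtain ⟨i, hi⟩ := hne
    have h0 := (hgood i hi).2
    refine ⟨(0, 2), ?_, ?_, fun j hj => ?_, ?_⟩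
    · simp only [marginScale]; linarith
    · simp only [marginScale]; linarith
    · simp only [marginScale]
      linarith [(hgood j hj).1]
    · rw [pow_zero]
      nlinarith
  · push Not at hbig
    have hρ : (0 : ℝ) < net.ρ l := by
      by_contra h
      have h0 : (net.ρ l : ℝ) = 0 := le_antisymm (not_lt.1 h) (net.ρ l).2
      rw [h0] at hbig
      linarith
    rcases le_total (net.ρ l : ℝ) γ with hle | hle
    · obtain ⟨q, hq1, hq2⟩ := exists_nat_pow_near ((one_le_div hρ).2 hle) (by norm_num : (1 : ℝ) < 4)
      rw [le_div_iff₀ hρ] at hq1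
      rw [div_lt_iff₀ hρ, pow_succ] at hq2
      refine ⟨(q, 0), ?_, ?_, fun j hj => ?_, ?_⟩
      · simp only [marginScale, hLl]; positivity
      · simp only [marginScale, hLl]; linarith
      · simp only [marginScale, hLl]
        have := hj.1
        linarith
      · have h1 : (4 : ℝ) ^ q ≤ 6 * (net.sigmaPrime l (A l) * B l) := by
          refine le_of_mul_le_mul_right ?_ hρ
          calc (4 : ℝ) ^ q * net.ρ l ≤ γ := hq1
            _ ≤ _ := by linarith
        have h2 : net.sigmaPrime l (A l) * B l ≤ Y * X :=
          mul_le_mul (by linarith) (by linarith) (by linarith) (by linarith)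
        have h3 : X * Y ≤ X * Y * (1 + R) := by nlinarith
        simp only
        linarith
    · obtain ⟨q, hq1, hq2⟩ := exists_nat_pow_near ((one_le_div hγ).2 hle) (by norm_num : (1 : ℝ) < 4)
      refine ⟨(q + 1, 1), ?_, ?_, fun j hj => ?_, ?_⟩
      · simp only [marginScale, hLl]; positivity
      · simp only [marginScale, hLl]
        rw [le_div_iff₀ hγ] at hq1
        rw [pow_succ, mul_div_assoc', le_div_iff₀ (by positivity)]
        linarith
      · simp only [marginScale, hLl]
        have := hj.1
        rw [div_lt_iff₀ hγ] at hq2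
        refine le_trans ?_ this.le
        rw [div_le_iff₀ (by positivity)]
        linarith
      · have h1 : (4 : ℝ) ^ (q + 1) ≤ 4 * (L * R) := by
          rw [pow_succ]; linarith
        have h2 : L * R ≤ X * (1 + R) := mul_le_mul (by linarith) (by linarith) hR0 (by linarith)
        have h3 : X * (1 + R) * 2 ≤ X * (1 + R) * Y := by gcongr
        have h4 : 0 ≤ X * (1 + R) := by positivity
        simp only
        nlinarith

theorem loss_eq_zero (hL : 0 < L) {A : ∀ l, net.Wt l} {γ : ℝ} {b : ℕ → ℝ}
    {p : net.Act 0 × Fin (net.U L)} (hγ : 0 < γ) (hb : ∀ l, l < L → 0 < b l)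
    (h1 : γ ≤ net.margin A p.1 p.2) (h2 : ∀ l, l < L → net.patchNorm l (net.F A l p.1) ≤ b l) :
    net.loss A γ b p = 0 := by
  have : Nonempty (Fin L) := ⟨⟨0, hL⟩⟩
  have h3 : net.lossArg A γ b p ≤ 0 := by
    rw [lossArg]
    refine max_le ?_ (ciSup_le fun l => ?_)
    · have := (one_le_div hγ).2 h1
      linarith
    · have := (div_le_one (hb l l.2)).2 (h2 l l.2)
      linarith
  rw [loss]
  exact max_eq_left ((min_le_right _ _).trans h3)

theorem loss_eq_one_of_mem_errorSet {A : ∀ l, net.Wt l} {γ : ℝ} {b : ℕ → ℝ}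
    {p : net.Act 0 × Fin (net.U L)} (hγ : 0 < γ) (h : p ∈ net.errorSet A) :
    net.loss A γ b p = 1 := by
  obtain ⟨c, hc, hle⟩ := h
  have h1 := le_ciSup (f := fun j : {j : Fin (net.U L) // j ≠ p.2} => net.score A p.1 j)
    (Set.finite_range _).bddAbove ⟨c, hc⟩
  have h2 : net.margin A p.1 p.2 ≤ 0 := by
    rw [margin]
    simp only at h1
    linarith
  have h3 : 1 ≤ net.lossArg A γ b p := by
    rw [lossArg]
    refine le_max_of_le_left ?_
    have := div_nonpos_of_nonpos_of_nonneg h2 hγ.le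
    linarith
  rw [loss, min_eq_left h3]
  simp

theorem measureReal_errorSet_le (μ : Measure (net.Act 0 × Fin (net.U L))) [IsProbabilityMeasure μ]
    (A : ∀ l, net.Wt l) {γ : ℝ} (hγ : 0 < γ) (b : ℕ → ℝ) :
    μ.real (net.errorSet A) ≤ ∫ p, net.loss A γ b p ∂μ := by
  have hm := (net.continuous_loss A γ b).measurable
  have hint : Integrable (net.loss A γ b) μ :=
    Integrable.of_bound hm.aestronglyMeasurable 1 (Filter.Eventually.of_forall fun p => by
      rw [Real.norm_eq_abs, abs_of_nonneg (net.loss_nonneg _ _ _ _)]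
      exact net.loss_le_one _ _ _ _)
  have h1 := mul_meas_ge_le_integral_of_nonneg
    (Filter.Eventually.of_forall fun p => net.loss_nonneg A γ b p) hint 1
  rw [one_mul] at h1
  refine le_trans (measureReal_mono fun p hp => ?_) h1
  exact (net.loss_eq_one_of_mem_errorSet hγ hp).ge

theorem sum_loss_le (hL : 0 < L) {n : ℕ} (S : Fin n → net.Act 0 × Fin (net.U L))
    {A : ∀ l, net.Wt l} {γ γ' : ℝ} {B b : ℕ → ℝ} (hγ' : 0 < γ') (hb : ∀ l, l < L → 0 < b l)
    (hBb : ∀ l, l < L → B l ≤ b l)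
    (hm : ∀ i ∈ net.goodSet A γ B S, γ' ≤ net.margin A (S i).1 (S i).2) :
    ∑ i, net.loss A γ' b (S i) ≤ n - (net.goodSet A γ B S).ncard := by
  classical
  have h1 : ∀ i, net.loss A γ' b (S i) ≤ 1 - if i ∈ net.goodSet A γ B S then 1 else 0 := by
    intro i
    split_ifs with h
    · rw [net.loss_eq_zero hL hγ' hb (hm i h) fun l hl => (h.2 l hl).trans (hBb l hl)]
      simp
    · simpa using net.loss_le_one _ _ _ _
  refine (Finset.sum_le_sum fun i _ => h1 i).trans (le_of_eq ?_)
  rw [Finset.sum_sub_distrib, Finset.sum_boole, Set.ncard_eq_toFinset_card']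
  simp

theorem specFactor_eq_sensitivity (A : ∀ l, net.Wt l) (B : ℕ → ℝ) (l : ℕ) :
    net.specFactor A B l = net.sensitivity (fun i => net.sigmaPrime i (A i) + 1 / (L : ℝ)) B l := rfl

theorem sensitivity_le {s s' b b' : ℕ → ℝ} {c : ℝ} (hc : 0 ≤ c) (hs : ∀ l, l < L → 0 ≤ s l)
    (hss : ∀ l, l < L → s l ≤ s' l) (hb : ∀ l, l ≤ L → 0 < b l)
    (hb' : ∀ l, l ≤ L → 0 < b' l) (hbb : ∀ l, l ≤ L → b' l ≤ c * b l) {i : ℕ} (hi : i < L) :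
    net.sensitivity s b i ≤ c * net.sensitivity s' b' i := by
  have : Nonempty (Finset.Icc (i + 1) L) := ⟨⟨L, Finset.mem_Icc.2 ⟨hi, le_rfl⟩⟩⟩
  rw [sensitivity, sensitivity, mul_left_comm]
  gcongr
  refine ciSup_le fun l => ?_
  have hl := Finset.mem_Icc.1 l.2
  refine le_trans ?_ (mul_le_mul_of_nonneg_left (le_ciSup (f := fun l : Finset.Icc (i + 1) L =>
    (∏ j ∈ Finset.Ico (i + 1) (l : ℕ), (net.ρ j : ℝ) * s' j) / b' l) (Set.finite_range _).bddAbove l) hc)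
  have h1 : ∏ j ∈ Finset.Ico (i + 1) (l : ℕ), (net.ρ j : ℝ) * s j ≤
      ∏ j ∈ Finset.Ico (i + 1) (l : ℕ), (net.ρ j : ℝ) * s' j := by
    refine Finset.prod_le_prod (fun j hj => ?_) fun j hj => ?_
    · have := hs j (by have := (Finset.mem_Ico.1 hj).2; omega)
      positivity
    · have := hss j (by have := (Finset.mem_Ico.1 hj).2; omega)
      gcongr
  have h0 : 0 ≤ ∏ j ∈ Finset.Ico (i + 1) (l : ℕ), (net.ρ j : ℝ) * s j :=
    Finset.prod_nonneg fun j hj => by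
      have := hs j (by have := (Finset.mem_Ico.1 hj).2; omega)
      positivity
  have hbl := hb l hl.2
  have hbl' := hb' l hl.2
  rw [mul_div_assoc', div_le_div_iff₀ hbl hbl']
  calc _ ≤ (∏ j ∈ Finset.Ico (i + 1) (l : ℕ), (net.ρ j : ℝ) * s j) * (c * b l) := by
        gcongr
        exact hbb l hl.2
    _ ≤ (∏ j ∈ Finset.Ico (i + 1) (l : ℕ), (net.ρ j : ℝ) * s' j) * (c * b l) := by gcongr
    _ = _ := by ring

/-- The activation bounds of a cell, followed by its margin scale. -/
noncomputable def cellB (θ : CellIndex L) : ℕ → ℝ := gridValue θ.2.2.1 (net.marginScale θ.2.2.2)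

theorem cellB_last (θ : CellIndex L) : net.cellB θ L = net.marginScale θ.2.2.2 := by
  simp [cellB, gridValue]

/-- The complexity of a cell. -/
noncomputable def cellComplexity (θ : CellIndex L) : ℝ :=
  quasiNorm L fun l => gridValue θ.1 0 l * (3 * net.cellB θ l) *
    net.sensitivity (gridValue θ.2.1 0) (net.cellB θ) l

/-- The deviation allowed in a cell. -/
noncomputable def cellDeviation (n : ℕ) (δ : ℝ) (θ : CellIndex L) : ℝ :=
  8 / n + 55 / Real.sqrt n * net.cellComplexity θ *
    Real.sqrt (Real.log (7 * net.prePoolWidth * n)) * Real.log n +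
    Real.sqrt (2 * -Real.log (δ * cellWeight θ) / n)

/-- The samples for which the deviation bound fails in a cell. -/
def badSet (μ : Measure (net.Act 0 × Fin (net.U L))) (M : ∀ l, net.Wt l) (n : ℕ) (δ : ℝ)
    (θ : CellIndex L) : Set (Fin n → net.Act 0 × Fin (net.U L)) :=
  {S | 0 < net.marginScale θ.2.2.2 ∧
    ∃ A ∈ net.weightClass M (gridValue θ.1 0) (gridValue θ.2.1 0),
      net.cellDeviation n δ θ < (∫ p, net.loss A (net.cellB θ L) (net.cellB θ) p ∂μ) -
        (∑ j, net.loss A (net.cellB θ L) (net.cellB θ) (S j)) / n}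

theorem le_prePoolWidth {l : ℕ} (hl : l < L) :
    (net.O l : ℝ) * net.m (l + 1) ≤ net.prePoolWidth :=
  le_ciSup (f := fun l : Fin L => (net.O l : ℝ) * (net.m (l + 1) : ℝ)) (Set.finite_range _).bddAbove
    ⟨l, hl⟩

theorem one_le_prePoolWidth (hL : 0 < L) : 1 ≤ net.prePoolWidth := by
  refine le_trans ?_ (net.le_prePoolWidth hL)
  have h1 : (1 : ℝ) ≤ net.O 0 := by exact_mod_cast net.O_pos 0 hL
  have h2 : (1 : ℝ) ≤ net.m (0 + 1) := by exact_mod_cast net.m_pos 0 hL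
  nlinarith

theorem cellWeight_le_one (θ : CellIndex L) : cellWeight θ ≤ 1 := by
  have h := (ENNReal.le_tsum θ).trans (tsum_cellWeight_le_one L)
  rwa [ENNReal.ofReal_le_one] at h

theorem measure_badSet_le (hfc : net.LastFullyConnected) (hK : 2 ≤ net.U L) (hL : 0 < L)
    {n : ℕ} (hn : 0 < n) (μ : Measure (net.Act 0 × Fin (net.U L))) [IsProbabilityMeasure μ]
    (M : ∀ l, net.Wt l) {δ : ℝ} (hδ : 0 < δ) (hδ1 : δ < 1) (θ : CellIndex L) :
    (Measure.pi fun _ : Fin n => μ) (net.badSet μ M n δ θ) ≤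
      ENNReal.ofReal δ * ENNReal.ofReal (cellWeight θ) := by
  have hn' : (0 : ℝ) < n := by exact_mod_cast hn
  by_cases hγ : 0 < net.marginScale θ.2.2.2
  · have hb : ∀ l, l ≤ L → 0 < net.cellB θ l := by
      intro l hl
      rcases hl.lt_or_eq with h | h
      · exact gridValue_pos _ _ h
      · rw [h, net.cellB_last]; exact hγ
    have key := net.measure_class_deviation_le hfc hK hL hn μ M (a := gridValue θ.1 0)
      (s := gridValue θ.2.1 0) (b := net.cellB θ) (fun l hl => gridValue_pos _ _ hl)
      (fun l hl => (gridValue_pos _ _ hl).le) hb (fun l hl => net.le_prePoolWidth hl)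
      (net.one_le_prePoolWidth hL) (t := Real.sqrt (2 * -Real.log (δ * cellWeight θ) / n))
      (Real.sqrt_nonneg _)
    refine (measure_mono ?_).trans (key.trans (le_of_eq ?_))
    · rintro S ⟨_, A, hA, h⟩
      exact ⟨A, hA, h⟩
    · have hw := cellWeight_pos θ
      have hlog : Real.log (δ * cellWeight θ) ≤ 0 :=
        Real.log_nonpos (by positivity) (mul_le_one₀ hδ1.le hw.le (cellWeight_le_one θ))
      rw [Real.sq_sqrt (div_nonneg (by linarith) hn'.le), ← ENNReal.ofReal_mul hδ.le]
      congr 1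
      rw [mul_div_cancel₀ _ hn'.ne']
      have : -(2 * -Real.log (δ * cellWeight θ) / 2) = Real.log (δ * cellWeight θ) := by ring
      rw [this, Real.exp_log (by positivity)]
  · rw [show net.badSet μ M n δ θ = ∅ from ?_, measure_empty]
    · exact zero_le
    · ext S
      simp [badSet, hγ]

theorem measure_iUnion_badSet_le (hfc : net.LastFullyConnected) (hK : 2 ≤ net.U L) (hL : 0 < L)
    {n : ℕ} (hn : 0 < n) (μ : Measure (net.Act 0 × Fin (net.U L))) [IsProbabilityMeasure μ]
    (M : ∀ l, net.Wt l) {δ : ℝ} (hδ : 0 < δ) (hδ1 : δ < 1) :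
    (Measure.pi fun _ : Fin n => μ) (⋃ θ, net.badSet μ M n δ θ) ≤ ENNReal.ofReal δ := by
  refine (measure_iUnion_le _).trans
    ((ENNReal.tsum_le_tsum fun θ => net.measure_badSet_le hfc hK hL hn μ M hδ hδ1 θ).trans ?_)
  rw [ENNReal.tsum_mul_left]
  exact mul_le_of_le_one_right' (tsum_cellWeight_le_one L)

end ConvArch

namespace ConvArch

variable {L : ℕ} (net : ConvArch L)

/-- The sum of logarithms that controls the cost of the choice of a cell. -/
noncomputable def logCost (M A : ∀ l, net.Wt l) (B : ℕ → ℝ) : ℝ :=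
  ∑ l ∈ Finset.range L, (Real.log (2 + L * B l) + Real.log (2 + net.dist21 l (A l) (M l)) +
    Real.log (2 + L * net.sigmaPrime l (A l)))

theorem log_one_add_le (R : ℝ) (hR : 0 ≤ R) : Real.log (1 + R) ≤ Real.log 2 + R ^ 2 := by
  have h1 : 1 + R ≤ 2 * (1 + R ^ 2) := by nlinarith [sq_nonneg (R - 1)]
  have h2 := Real.log_le_log (by positivity) h1
  rw [Real.log_mul (by norm_num) (by positivity)] at h2
  have h3 := Real.log_le_sub_one_of_pos (show 0 < 1 + R ^ 2 by positivity)
  linarith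

theorem log_cellWeight_bound {l : ℕ} (hl : l + 1 = L) (M A : ∀ l, net.Wt l) {B : ℕ → ℝ}
    (hB : ∀ l, l < L → 1 ≤ B l) {R : ℝ} (hR0 : 0 ≤ R) {δ : ℝ} (hδ : 0 < δ) (hδ1 : δ < 1)
    {q : ℕ × Fin 3}
    (hq : (4 : ℝ) ^ q.1 ≤ 6 * (2 + L * B l) * (2 + L * net.sigmaPrime l (A l)) * (1 + R)) :
    2 * -Real.log (δ * cellWeight (gridIndex L fun l => net.dist21 l (A l) (M l),
      gridIndex L fun l => net.sigmaPrime l (A l), gridIndex L B, q)) ≤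
      9 / 2 * Real.log (2 / δ) + 9 * net.logCost M A B + R ^ 2 := by
  have hL1 : (1 : ℝ) ≤ L := by exact_mod_cast (by omega : 1 ≤ L)
  have hd0 : ∀ l, 0 ≤ net.dist21 l (A l) (M l) := fun l => net.dist21_nonneg _ _ _
  have hσ0 : ∀ l, 0 ≤ net.sigmaPrime l (A l) := fun l => net.sigmaPrime_nonneg _ _
  have w1 := familyWeight_pos (gridIndex L fun l => net.dist21 l (A l) (M l))
  have w2 := familyWeight_pos (gridIndex L fun l => net.sigmaPrime l (A l))
  have w3 := familyWeight_pos (gridIndex L B)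
  have w4 := scaleWeight_pos q
  have c1 := log_inv_familyWeight_le (L := L) (v := fun l => net.dist21 l (A l) (M l))
    fun l _ => hd0 l
  have c2 := log_inv_familyWeight_le (L := L) (v := fun l => net.sigmaPrime l (A l))
    fun l _ => hσ0 l
  have c3 := log_inv_familyWeight_le (L := L) (v := B) fun l hl => zero_le_one.trans (hB l hl)
  set b := ∑ l ∈ Finset.range L, Real.log (2 + L * B l) with hb
  set d := ∑ l ∈ Finset.range L, Real.log (2 + net.dist21 l (A l) (M l)) with hd
  set e := ∑ l ∈ Finset.range L, Real.log (2 + L * net.sigmaPrime l (A l)) with he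
  have hcost : net.logCost M A B = b + d + e := by
    rw [logCost, Finset.sum_add_distrib, Finset.sum_add_distrib]
  have hdist : ∑ l ∈ Finset.range L, Real.log (2 + L * net.dist21 l (A l) (M l)) ≤ d + b := by
    rw [hd, hb, ← Finset.sum_add_distrib]
    refine Finset.sum_le_sum fun i hi => ?_
    have hBi := hB i (Finset.mem_range.1 hi)
    have hdi := hd0 i
    rw [← Real.log_mul (by positivity) (by positivity)]
    refine Real.log_le_log (by positivity) ?_
    have h1 : L * net.dist21 i (A i) (M i) ≤ net.dist21 i (A i) (M i) * (L * B i) := by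
      have : L * net.dist21 i (A i) (M i) * 1 ≤ L * net.dist21 i (A i) (M i) * B i := by gcongr
      linarith
    have h2 : 0 ≤ L * B i := by positivity
    nlinarith
  have hlB : ∀ i ∈ Finset.range L, 0 ≤ Real.log (2 + L * B i) := fun i hi => by
    have hBi := hB i (Finset.mem_range.1 hi)
    have : 0 ≤ L * B i := by positivity
    exact Real.log_nonneg (by linarith)
  have hlσ : ∀ i ∈ Finset.range L, 0 ≤ Real.log (2 + L * net.sigmaPrime i (A i)) := fun i _ => by
    have := hσ0 i
    have : 0 ≤ L * net.sigmaPrime i (A i) := by positivity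
    exact Real.log_nonneg (by linarith)
  have hld : ∀ i ∈ Finset.range L, 0 ≤ Real.log (2 + net.dist21 i (A i) (M i)) := fun i _ => by
    have := hd0 i
    exact Real.log_nonneg (by linarith)
  have hmem : l ∈ Finset.range L := Finset.mem_range.2 (by omega)
  have hx : Real.log (2 + L * B l) ≤ b :=
    Finset.single_le_sum (f := fun l => Real.log (2 + L * B l)) hlB hmem
  have hy : Real.log (2 + L * net.sigmaPrime l (A l)) ≤ e :=
    Finset.single_le_sum (f := fun l => Real.log (2 + L * net.sigmaPrime l (A l))) hlσ hmem
  have hz : Real.log (2 + net.dist21 l (A l) (M l)) ≤ d :=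
    Finset.single_le_sum (f := fun l => Real.log (2 + net.dist21 l (A l) (M l))) hld hmem
  have hy2 : Real.log 2 ≤ Real.log (2 + L * net.sigmaPrime l (A l)) := by
    have := hσ0 l
    refine Real.log_le_log (by norm_num) ?_
    have : 0 ≤ L * net.sigmaPrime l (A l) := by positivity
    linarith
  have hz2 : Real.log 2 ≤ Real.log (2 + net.dist21 l (A l) (M l)) := by
    have := hd0 l
    exact Real.log_le_log (by norm_num) (by linarith)
  have hBl := hB l (by omega)
  have hσl := hσ0 l
  have hq' : (q.1 : ℝ) * (2 * Real.log 2) ≤ Real.log 6 + Real.log (2 + L * B l) +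
      Real.log (2 + L * net.sigmaPrime l (A l)) + Real.log (1 + R) := by
    have h := Real.log_le_log (by positivity) hq
    rw [Real.log_pow, Real.log_mul (by positivity) (by positivity),
      Real.log_mul (by positivity) (by positivity), Real.log_mul (by positivity) (by positivity)] at h
    have h4 : Real.log 4 = 2 * Real.log 2 := by
      rw [show (4 : ℝ) = 2 ^ 2 by norm_num, Real.log_pow]; push_cast; ring
    rwa [h4] at h
  have hscale : -Real.log (scaleWeight q) = (q.1 + 1) * Real.log 2 + Real.log 3 := by
    rw [scaleWeight, Real.log_div (by positivity) (by norm_num), Real.log_pow, one_div, Real.log_inv]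
    push_cast
    ring
  have hlog6 : Real.log 6 = Real.log 2 + Real.log 3 := by
    rw [← Real.log_mul (by norm_num) (by norm_num)]; norm_num
  have hlog3 : Real.log 3 ≤ 2 * Real.log 2 := by
    have h := Real.log_le_log (by norm_num) (show (3 : ℝ) ≤ 2 ^ 2 by norm_num)
    rw [Real.log_pow] at h
    exact_mod_cast h
  have hlogR := log_one_add_le R hR0
  have hlogδ : Real.log δ < 0 := Real.log_neg hδ hδ1
  rw [cellWeight, Real.log_mul hδ.ne' (by positivity), Real.log_mul w1.ne' (by positivity),
    Real.log_mul w2.ne' (by positivity), Real.log_mul w3.ne' w4.ne', hcost,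
    Real.log_div two_ne_zero hδ.ne']
  have hlog2 : 0 < Real.log 2 := Real.log_pos one_lt_two
  linarith

theorem sqrt_add_le_add_sqrt {x y z : ℝ} (hx : 0 ≤ x) (hy : 0 ≤ y) (hz : 0 ≤ z) :
    Real.sqrt (x + y + z ^ 2) ≤ Real.sqrt x + Real.sqrt y + z := by
  rw [Real.sqrt_le_iff]
  refine ⟨by positivity, ?_⟩
  nlinarith [Real.sq_sqrt hx, Real.sq_sqrt hy, mul_nonneg (Real.sqrt_nonneg x) (Real.sqrt_nonneg y),
    mul_nonneg (Real.sqrt_nonneg x) hz, mul_nonneg (Real.sqrt_nonneg y) hz]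

theorem complexityR_eq_quasiNorm (M A : ∀ l, net.Wt l) (B : ℕ → ℝ) :
    net.complexityR M A B = quasiNorm L fun l => (net.dist21 l (A l) (M l) + 1 / (L : ℝ)) *
      (B l + 1 / (L : ℝ)) * net.specFactor A B l := rfl

/-- Comparison of the main terms of the deviation in a cell and of the generalisation bound. -/
theorem main_term_le {n R C W Γ : ℝ} (hn9 : 9 ≤ n) (hR0 : 0 ≤ R) (hC : C ≤ 12 * R) (hW1 : 1 ≤ W)
    (hΓ0 : 0 ≤ Γ) :
    55 / Real.sqrt n * C * Real.sqrt (Real.log (7 * W * n)) * Real.log n + R / Real.sqrt n ≤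
      3072 / Real.sqrt n * R * Real.sqrt (Real.logb 2 (64 * Γ * n ^ 2 + 7 * W * n)) *
        Real.log n := by
  have hn' : 0 < n := by linarith
  set V := Real.logb 2 (64 * Γ * n ^ 2 + 7 * W * n) with hV
  have hWn : n ≤ W * n := le_mul_of_one_le_left hn'.le hW1
  have hlogn : 1 ≤ Real.log n := by
    rw [Real.le_log_iff_exp_le hn']
    linarith [Real.exp_one_lt_d9]
  have hlog7 : 1 ≤ Real.log (7 * W * n) := hlogn.trans (Real.log_le_log hn' (by linarith))
  have hlogV : Real.log (7 * W * n) ≤ V := by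
    rw [hV, Real.logb, le_div_iff₀ (Real.log_pos one_lt_two)]
    have h1 : Real.log (7 * W * n) ≤ Real.log (64 * Γ * n ^ 2 + 7 * W * n) :=
      Real.log_le_log (by linarith) (by
        have : 0 ≤ 64 * Γ * n ^ 2 := by positivity
        linarith)
    have h3 : Real.log 2 ≤ 1 := by linarith [Real.log_two_lt_d9]
    exact (mul_le_of_le_one_right (by linarith) h3).trans h1
  have hsV : 1 ≤ Real.sqrt V := Real.one_le_sqrt.2 (hlog7.trans hlogV)
  have h1 : 55 / Real.sqrt n * C * Real.sqrt (Real.log (7 * W * n)) * Real.log n ≤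
      55 / Real.sqrt n * (12 * R) * Real.sqrt V * Real.log n := by
    gcongr
  have h2 : R / Real.sqrt n ≤ R / Real.sqrt n * (Real.sqrt V * Real.log n) :=
    le_mul_of_one_le_right (by positivity) (one_le_mul_of_one_le_of_one_le hsV hlogn)
  have h3 : 0 ≤ R / Real.sqrt n * (Real.sqrt V * Real.log n) := by positivity
  calc _ ≤ 55 / Real.sqrt n * (12 * R) * Real.sqrt V * Real.log n +
        R / Real.sqrt n * (Real.sqrt V * Real.log n) := add_le_add h1 h2
    _ = 661 * (R / Real.sqrt n * (Real.sqrt V * Real.log n)) := by ring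
    _ ≤ 3072 * (R / Real.sqrt n * (Real.sqrt V * Real.log n)) := by linarith
    _ = _ := by ring

/-- The complexity of the cell of given weights. -/
theorem cellComplexity_le (M A : ∀ l, net.Wt l) {γ : ℝ} {B : ℕ → ℝ} (hγ : 0 < γ)
    (hB : ∀ l, l < L → 1 ≤ B l) (hBL : B L = γ) {q : ℕ × Fin 3} (hq0 : 0 < net.marginScale q)
    (hqγ : γ ≤ 4 * net.marginScale q) :
    net.cellComplexity (gridIndex L fun l => net.dist21 l (A l) (M l),
      gridIndex L fun l => net.sigmaPrime l (A l), gridIndex L B, q) ≤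
        12 * net.complexityR M A B := by
  set θ : CellIndex L := (gridIndex L fun l => net.dist21 l (A l) (M l),
      gridIndex L fun l => net.sigmaPrime l (A l), gridIndex L B, q) with hθ
  have hd0 : ∀ l, 0 ≤ net.dist21 l (A l) (M l) := fun l => net.dist21_nonneg _ _ _
  have hσ0 : ∀ l, 0 ≤ net.sigmaPrime l (A l) := fun l => net.sigmaPrime_nonneg _ _
  have hBpos : ∀ l, l ≤ L → 0 < B l := by
    intro l hl
    rcases hl.lt_or_eq with h | h
    · exact lt_of_lt_of_le zero_lt_one (hB l h)
    · rw [h, hBL]; exact hγ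
  have hP0 : ∀ l, 0 ≤ net.specFactor A B l := fun l => by
    rw [specFactor_eq_sensitivity]
    exact net.sensitivity_nonneg (fun l _ => by have := hσ0 l; positivity)
      (fun l hl => (hBpos l hl).le) l
  have ht0 : ∀ l, l < L → 0 ≤ (net.dist21 l (A l) (M l) + 1 / (L : ℝ)) *
      (B l + 1 / (L : ℝ)) * net.specFactor A B l := fun l hl => by
    have := hd0 l
    have := hP0 l
    have := hBpos l hl.le
    positivity
  have hbpos : ∀ l, l ≤ L → 0 < net.cellB θ l := by
    intro l hl
    rcases hl.lt_or_eq with h | h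
    · exact gridValue_pos _ _ h
    · rw [h, net.cellB_last]; exact hq0
  have hBb : ∀ l, l < L → B l ≤ net.cellB θ l := fun l hl => le_gridValue (v := B) _ hl
  rw [complexityR_eq_quasiNorm, ← quasiNorm_const_mul (by norm_num) ht0]
  have hsens0 := net.sensitivity_nonneg (s := gridValue θ.2.1 0) (b := net.cellB θ)
    (fun l hl => (gridValue_pos _ _ hl).le) fun l hl => (hbpos l hl).le
  refine quasiNorm_mono (fun l hl => ?_) fun l hl => ?_
  · have := gridValue_pos θ.1 0 hl
    have := hbpos l hl.le
    have := hsens0 l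
    positivity
  · have h1 : gridValue θ.1 0 l ≤ net.dist21 l (A l) (M l) + 1 / L :=
      gridValue_le (v := fun l => net.dist21 l (A l) (M l)) 0 hl (hd0 l)
    have h2 : net.cellB θ l ≤ B l + 1 / L := gridValue_le (v := B) _ hl (hBpos l hl.le).le
    have h3 : net.sensitivity (gridValue θ.2.1 0) (net.cellB θ) l ≤ 4 * net.specFactor A B l := by
      rw [specFactor_eq_sensitivity]
      refine net.sensitivity_le (by norm_num) (fun l hl => (gridValue_pos _ _ hl).le)
        (fun l hl => gridValue_le (v := fun l => net.sigmaPrime l (A l)) 0 hl (hσ0 l)) hbpos hBpos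
        (fun l hl => ?_) hl
      rcases hl.lt_or_eq with h | h
      · linarith [hBb l h, hbpos l h.le]
      · rw [h, hBL, net.cellB_last]; exact hqγ
    have p1 := gridValue_pos θ.1 0 hl
    have p2 := hbpos l hl.le
    have p3 := hsens0 l
    have p4 := hd0 l
    have p5 := hBpos l hl.le
    calc gridValue θ.1 0 l * (3 * net.cellB θ l) * net.sensitivity (gridValue θ.2.1 0) (net.cellB θ) l
        ≤ (net.dist21 l (A l) (M l) + 1 / L) * (3 * (B l + 1 / L)) * (4 * net.specFactor A B l) := by
          gcongr
      _ = _ := by ring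

/-- The generalisation bound on the complement of the bad samples. -/
theorem errorSet_le_of_notMem_badSet (hfc : net.LastFullyConnected) (hK : 2 ≤ net.U L) (hL : 0 < L)
    {n : ℕ} (hn : 0 < n) (μ : Measure (net.Act 0 × Fin (net.U L))) [IsProbabilityMeasure μ]
    (M : ∀ l, net.Wt l) {δ : ℝ} (hδ : 0 < δ) (hδ1 : δ < 1)
    {S : Fin n → net.Act 0 × Fin (net.U L)} (hS : S ∉ ⋃ θ, net.badSet μ M n δ θ)
    (A : ∀ l, net.Wt l) {γ : ℝ} {B : ℕ → ℝ} (hγ : 0 < γ) (hB : ∀ l, l < L → 1 ≤ B l)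
    (hBL : B L = γ) :
    μ.real (net.errorSet A) ≤
      ((n : ℝ) - ((net.goodSet A γ B S).ncard : ℝ)) / n + 8 / n +
      3072 / Real.sqrt n * net.complexityR M A B *
        Real.sqrt (Real.logb 2
          (64 * net.complexityGamma M A B * (n : ℝ) ^ 2 + 7 * net.prePoolWidth * n)) *
        Real.log n +
      3 * Real.sqrt (Real.log (2 / δ) / (2 * n)) +
      3 * Real.sqrt (1 / n * net.logCost M A B) := by
  obtain ⟨l, hl⟩ : ∃ l, l + 1 = L := ⟨L - 1, by omega⟩
  have hn' : (0 : ℝ) < n := by exact_mod_cast hn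
  have hn1 : (1 : ℝ) ≤ n := by exact_mod_cast hn
  have hLpos : (0 : ℝ) < L := by exact_mod_cast hL
  have hinv : (0 : ℝ) < 1 / L := by positivity
  have hd0 : ∀ l, 0 ≤ net.dist21 l (A l) (M l) := fun l => net.dist21_nonneg _ _ _
  have hσ0 : ∀ l, 0 ≤ net.sigmaPrime l (A l) := fun l => net.sigmaPrime_nonneg _ _
  have hBpos : ∀ l, l ≤ L → 0 < B l := by
    intro l hl
    rcases hl.lt_or_eq with h | h
    · exact lt_of_lt_of_le zero_lt_one (hB l h)
    · rw [h, hBL]; exact hγ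
  have hP0 : ∀ l, 0 ≤ net.specFactor A B l := fun l => by
    rw [specFactor_eq_sensitivity]
    exact net.sensitivity_nonneg (fun l _ => by have := hσ0 l; positivity)
      (fun l hl => (hBpos l hl).le) l
  have ht0 : ∀ l, l < L → 0 ≤ (net.dist21 l (A l) (M l) + 1 / (L : ℝ)) *
      (B l + 1 / (L : ℝ)) * net.specFactor A B l := fun l hl => by
    have := hd0 l
    have := hP0 l
    have := hBpos l hl.le
    positivity
  set R := net.complexityR M A B with hR
  have hR0 : 0 ≤ R := quasiNorm_nonneg ht0
  have hΓ0 : 0 ≤ net.complexityGamma M A B := Real.iSup_nonneg fun l => by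
    have := hd0 l
    have := hP0 l
    have := hBpos l l.2.le
    positivity
  have hW1 := net.one_le_prePoolWidth hL
  have hcost0 : 0 ≤ net.logCost M A B := Finset.sum_nonneg fun i hi => by
    have h1 := hBpos i (Finset.mem_range.1 hi).le
    have h2 := hd0 i
    have h3 := hσ0 i
    have h4 : 0 ≤ L * B i := by positivity
    have h5 : 0 ≤ L * net.sigmaPrime i (A i) := by positivity
    have := Real.log_nonneg (show 1 ≤ 2 + L * B i by linarith)
    have := Real.log_nonneg (show 1 ≤ 2 + net.dist21 i (A i) (M i) by linarith)
    have := Real.log_nonneg (show 1 ≤ 2 + L * net.sigmaPrime i (A i) by linarith)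
    positivity
  have hncard : ((net.goodSet A γ B S).ncard : ℝ) ≤ n := by
    have := Set.ncard_le_card (net.goodSet A γ B S)
    rw [Nat.card_eq_fintype_card, Fintype.card_fin] at this
    exact_mod_cast this
  have hT1 : 0 ≤ ((n : ℝ) - ((net.goodSet A γ B S).ncard : ℝ)) / n :=
    div_nonneg (by linarith) hn'.le
  have hlogn0 : 0 ≤ Real.log n := Real.log_nonneg hn1
  have hT3 : 0 ≤ 3072 / Real.sqrt n * R * Real.sqrt (Real.logb 2
      (64 * net.complexityGamma M A B * (n : ℝ) ^ 2 + 7 * net.prePoolWidth * n)) * Real.log n := by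
    positivity
  have hT4 : 0 ≤ 3 * Real.sqrt (Real.log (2 / δ) / (2 * n)) := by positivity
  have hT6 : 0 ≤ 3 * Real.sqrt (1 / n * net.logCost M A B) := by positivity
  have hT2 : 0 ≤ 8 / (n : ℝ) := by positivity
  have hone : μ.real (net.errorSet A) ≤ 1 := measureReal_le_one
  rcases (net.goodSet A γ B S).eq_empty_or_nonempty with hempty | hne
  · have : ((n : ℝ) - ((net.goodSet A γ B S).ncard : ℝ)) / n = 1 := by
      rw [hempty]; simp [hn'.ne']
    linarith
  rcases le_or_gt n 8 with hn8 | hn8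
  · have : 1 ≤ 8 / (n : ℝ) := by
      rw [le_div_iff₀ hn']
      have : (n : ℝ) ≤ 8 := by exact_mod_cast hn8
      linarith
    linarith
  have hRρ : net.ρ l / γ ≤ L * R := by
    have h1 := le_quasiNorm ht0 (l := l) (by omega)
    rw [← complexityR_eq_quasiNorm, ← hR] at h1
    have h2 : net.ρ l / γ ≤ net.specFactor A B l := by
      have h := net.le_sensitivity (fun i => net.sigmaPrime i (A i) + 1 / (L : ℝ)) B
        (i := l) (l := L) (by omega) le_rfl
      rw [← specFactor_eq_sensitivity, hl, Finset.Ico_self, hfc.1, hBL] at h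
      simpa using h
    have h3 : 1 / (L : ℝ) * 1 * (net.ρ l / γ) ≤ R := by
      refine le_trans ?_ h1
      have := hB l (by omega)
      have := hd0 l
      have : 0 ≤ (net.ρ l : ℝ) / γ := by positivity
      refine mul_le_mul (mul_le_mul ?_ ?_ ?_ ?_) h2 this ?_ <;> first | linarith | positivity
    have := mul_le_mul_of_nonneg_left h3 hLpos.le
    calc (net.ρ l : ℝ) / γ = L * (1 / (L : ℝ) * 1 * (net.ρ l / γ)) := by field_simp
      _ ≤ _ := this
  obtain ⟨q, hq0, hqγ, hqm, hq4⟩ := net.exists_marginScale hfc hK hl S A hγ hB hR0 hRρ hne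
  set θ : CellIndex L := (gridIndex L fun l => net.dist21 l (A l) (M l),
      gridIndex L fun l => net.sigmaPrime l (A l), gridIndex L B, q) with hθ
  have hbpos : ∀ l, l ≤ L → 0 < net.cellB θ l := by
    intro l hl
    rcases hl.lt_or_eq with h | h
    · exact gridValue_pos _ _ h
    · rw [h, net.cellB_last]; exact hq0
  have hclass : A ∈ net.weightClass M (gridValue θ.1 0) (gridValue θ.2.1 0) := fun l hl =>
    ⟨le_gridValue (v := fun l => net.dist21 l (A l) (M l)) 0 hl,
      le_gridValue (v := fun l => net.sigmaPrime l (A l)) 0 hl⟩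
  have hdev : (∫ p, net.loss A (net.cellB θ L) (net.cellB θ) p ∂μ) -
      (∑ j, net.loss A (net.cellB θ L) (net.cellB θ) (S j)) / n ≤ net.cellDeviation n δ θ := by
    by_contra! h
    exact hS (Set.mem_iUnion.2 ⟨θ, hq0, A, hclass, h⟩)
  have herr := net.measureReal_errorSet_le μ A (γ := net.cellB θ L) (hbpos L le_rfl) (net.cellB θ)
  have hBb : ∀ l, l < L → B l ≤ net.cellB θ l := fun l hl => le_gridValue (v := B) _ hl
  have hemp := net.sum_loss_le hL S (A := A) (γ := γ) (γ' := net.cellB θ L) (B := B)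
    (b := net.cellB θ) (hbpos L le_rfl) (fun l hl => hbpos l hl.le) hBb
    (by rw [net.cellB_last]; exact hqm)
  have hemp' : (∑ j, net.loss A (net.cellB θ L) (net.cellB θ) (S j)) / n ≤
      ((n : ℝ) - ((net.goodSet A γ B S).ncard : ℝ)) / n := by gcongr
  have hcomp := net.cellComplexity_le M A hγ hB hBL hq0 hqγ
  have hcell := net.log_cellWeight_bound hl M A hB hR0 hδ hδ1 hq4
  rw [← hθ] at hcell
  have hlogδ : 0 ≤ Real.log (2 / δ) := Real.log_nonneg (by rw [le_div_iff₀ hδ]; linarith)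
  have hsq : Real.sqrt (2 * -Real.log (δ * cellWeight θ) / n) ≤
      3 * Real.sqrt (Real.log (2 / δ) / (2 * n)) + 3 * Real.sqrt (1 / n * net.logCost M A B) +
        R / Real.sqrt n := by
    have h9 : ∀ x : ℝ, 3 * Real.sqrt x = Real.sqrt (9 * x) := fun x => by
      rw [Real.sqrt_mul (by norm_num), show (9 : ℝ) = 3 ^ 2 by norm_num,
        Real.sqrt_sq (by norm_num)]
    rw [h9, h9]
    refine le_trans (Real.sqrt_le_sqrt ?_)
      (sqrt_add_le_add_sqrt (by positivity) (by positivity) (by positivity))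
    rw [div_pow, Real.sq_sqrt hn'.le, div_le_iff₀ hn']
    refine hcell.trans (le_of_eq ?_)
    field_simp
  have hn9 : (9 : ℝ) ≤ n := by exact_mod_cast hn8
  have hmain := main_term_le hn9 hR0 hcomp hW1 hΓ0
  rw [cellDeviation] at hdev
  linarith

theorem goodSet_empiricalB {n : ℕ} (S : Fin n → net.Act 0 × Fin (net.U L)) (A : ∀ l, net.Wt l)
    (γ : ℝ) : net.goodSet A γ (net.empiricalB A γ S) S = {i | γ < net.margin A (S i).1 (S i).2} := by
  ext i
  refine ⟨fun h => h.1, fun h => ⟨h, fun l hl => ?_⟩⟩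
  rw [empiricalB, if_neg hl.ne]
  exact le_max_of_le_left (le_ciSup (f := fun i => net.patchNorm l (net.F A l (S i).1))
    (Set.finite_range _).bddAbove i)

end ConvArch

theorem conv_generalisation_post_hoc_spectral
    (L n : ℕ) (hL : 0 < L) (hn : 0 < n)
    (net : ConvArch L) (hfc : net.LastFullyConnected) (hK : 2 ≤ net.U L)
    (μ : Measure (net.Act 0 × Fin (net.U L))) [IsProbabilityMeasure μ]
    (M : ∀ l, net.Wt l) (δ : ℝ) (hδ : 0 < δ) :
    ENNReal.ofReal (1 - δ) ≤
      (Measure.pi fun _ : Fin n => μ)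
        {s : Fin n → net.Act 0 × Fin (net.U L) |
          ∀ (A : ∀ l, net.Wt l) (γ : ℝ) (B : ℕ → ℝ),
            0 < γ → (∀ l, l < L → 1 ≤ B l) → B L = γ →
            μ.real (net.errorSet A) ≤
              ((n : ℝ) - ((net.goodSet A γ B s).ncard : ℝ)) / n + 8 / n +
              3072 / Real.sqrt n * net.complexityR M A B *
                Real.sqrt (Real.logb 2
                  (64 * net.complexityGamma M A B * (n : ℝ) ^ 2 + 7 * net.prePoolWidth * n)) *
                Real.log n +
              3 * Real.sqrt (Real.log (2 / δ) / (2 * n)) +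
              Real.sqrt (Real.log (2 / (γ * n))) +
              3 * Real.sqrt (1 / n * ∑ l ∈ Finset.range L,
                (Real.log (2 + L * B l) +
                  Real.log (2 + net.dist21 l (A l) (M l)) +
                  Real.log (2 + L * net.sigmaPrime l (A l))))} ∧
    ∀ (s : Fin n → net.Act 0 × Fin (net.U L)) (A : ∀ l, net.Wt l) (γ : ℝ), 0 < γ →
      net.goodSet A γ (net.empiricalB A γ s) s = {i | γ < net.margin A (s i).1 (s i).2} := by
  refine ⟨?_, fun s A γ _ => net.goodSet_empiricalB s A γ⟩
  rcases le_or_gt 1 δ with hδ1 | hδ1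
  · rw [ENNReal.ofReal_of_nonpos (by linarith)]
    exact zero_le
  set P := Measure.pi fun _ : Fin n => μ
  have hbad := net.measure_iUnion_badSet_le hfc hK hL hn μ M hδ hδ1
  have hcompl : 1 ≤ P (⋃ θ, net.badSet μ M n δ θ)ᶜ + P (⋃ θ, net.badSet μ M n δ θ) := by
    rw [← measure_univ (μ := P), ← Set.compl_union_self (⋃ θ, net.badSet μ M n δ θ)]
    exact measure_union_le _ _
  rw [ENNReal.ofReal_sub _ hδ.le, ENNReal.ofReal_one, tsub_le_iff_right]
  refine hcompl.trans (add_le_add (measure_mono fun S hS A γ B hγ hB hBL => ?_) hbad)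
  have h := net.errorSet_le_of_notMem_badSet hfc hK hL hn μ M hδ hδ1 hS A hγ hB hBL
  have h0 : 0 ≤ Real.sqrt (Real.log (2 / (γ * n))) := Real.sqrt_nonneg _
  rw [ConvArch.logCost] at h
  linarith
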